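/- arXiv:2306.11328 — 3 statements merged into one kernel-verified Lean document; each statement's English description precedes it below -/
import Mathlib

section
/- Let a and b be integers with a ≥ b ≥ 1 and 2(a+b) < n−5. Then Mo(F_{n,a−1,b+1}) < Mo(F_{n,a,b}). -/
open Finset SimpleGraph

open scoped Classical

/-- ψ(uv) = |n_u - n_v| for an edge, as a symmetric function on `Sym2 V`. -/
noncomputable def mostarPsi {V : Type*} [Fintype V] (G : SimpleGraph V) : Sym2 V → ℕ :=
  Sym2.lift ⟨fun u v =>
    (((Finset.univ.filter fun w => G.dist w u < G.dist w v).card : ℤ) -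
      ((Finset.univ.filter fun w => G.dist w v < G.dist w u).card : ℤ)).natAbs,
    fun u v => by dsimp only; omega⟩

/-- The Mostar index of a graph. -/
noncomputable def mostar {V : Type*} [Fintype V] (G : SimpleGraph V) : ℕ :=
  ∑ e ∈ G.edgeFinset, mostarPsi G e

/-- The graph on `Fin n` determined by a parent function. -/
def parentGraph (n : ℕ) (p : ℕ → ℕ) : SimpleGraph (Fin n) :=
  SimpleGraph.fromRel (fun u v => p u.val = v.val)

/-- S_{n,r}: r pendent paths of almost equal lengths at a common vertex. -/
def spiderS (n r : ℕ) : SimpleGraph (Fin n) :=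
  parentGraph n (fun v => if v ≤ r then 0 else v - r)

/-- The star on n vertices. -/
def starG (n : ℕ) : SimpleGraph (Fin n) :=
  parentGraph n (fun _ => 0)

/-- C_{n,a,b}. -/
def catC (n a b : ℕ) : SimpleGraph (Fin n) :=
  parentGraph n (fun v =>
    if v < n - a - b then v - 1
    else if v < n - b then v - (n - a - b) + 1
    else v - a - b - 1)

/-- F_{n,a,b}. -/
def catF (n a b : ℕ) : SimpleGraph (Fin n) :=
  parentGraph n (fun v =>
    if v < n - a - b - 2 then v - 1
    else if v = n - a - b - 2 then 1
    else if v < n - b then v - (n - a - b - 2)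
    else v - a - b - 3)

/-- A^r_{n,a,b}. -/
def treeA (n r a b : ℕ) : SimpleGraph (Fin n) :=
  parentGraph n (fun v =>
    if v < n - (a + b) * r then v - 1
    else if v < n - b * r then (if (v - (n - (a + b) * r)) % r = 0 then 0 else v - 1)
    else (if (v - (n - b * r)) % r = 0 then n - (a + b) * r - 1 else v - 1))

/-- S^r_{n,k}: k pendent paths of length r and n - k*r - 1 pendent edges at a common vertex. -/
def treeSrk (n r k : ℕ) : SimpleGraph (Fin n) :=
  parentGraph n (fun v =>
    if v < n - k * r then 0
    else if (v - (n - k * r)) % r = 0 then 0 else v - 1)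

/-- Number of vertices of odd degree. -/
noncomputable def oddDegreeCount {V : Type*} [Fintype V] (G : SimpleGraph V) : ℕ :=
  (Finset.univ.filter fun v => Odd (G.degree v)).card

/-- Number of vertices of degree two. -/
noncomputable def degreeTwoCount {V : Type*} [Fintype V] (G : SimpleGraph V) : ℕ :=
  (Finset.univ.filter fun v => G.degree v = 2).card

/-- Number of branch vertices (degree at least three). -/
noncomputable def branchCount {V : Type*} [Fintype V] (G : SimpleGraph V) : ℕ :=
  (Finset.univ.filter fun v => 3 ≤ G.degree v).card

/-- Number of pendent paths of length r in G. -/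
noncomputable def pendentPathCount {V : Type*} [Fintype V] (G : SimpleGraph V) (r : ℕ) : ℕ :=
  Nat.card { u : Fin (r + 1) → V //
    Function.Injective u ∧
    (∀ i : Fin r, G.Adj (u i.castSucc) (u i.succ)) ∧
    G.degree (u 0) = 1 ∧ 2 ≤ G.degree (u (Fin.last r)) ∧
    ∀ i : Fin (r + 1), i ≠ 0 → i ≠ Fin.last r → G.degree (u i) = 2 }

lemma exists_walk_lt {V : Type*} (G : SimpleGraph V) (S : V → Prop) (u v : V)
    (hcut : ∀ x y, G.Adj x y → S x → ¬ S y → x = u) (hv : ¬ S v) :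
    ∀ (w z : V) (q : G.Walk w z), z = v → S w → ∃ r : G.Walk w u, r.length < q.length := by
  intro w z q
  induction q with
  | nil => intro hz hw; exact absurd (hz ▸ hw) hv
  | @cons x y z h q ih =>
    intro hz hx
    by_cases hy : S y
    · obtain ⟨r, hr⟩ := ih hz hy
      exact ⟨SimpleGraph.Walk.cons h r, by simpa using hr⟩
    · obtain rfl := hcut x y h hx hy
      exact ⟨SimpleGraph.Walk.nil, by simp⟩

lemma dist_lt_of_cut {V : Type*} (G : SimpleGraph V) (hG : G.Connected) (S : V → Prop) (u v : V)
    (hcut : ∀ x y, G.Adj x y → S x → ¬ S y → x = u) (hv : ¬ S v) (w : V) (hw : S w) :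
    G.dist w u < G.dist w v := by
  obtain ⟨q, hq⟩ := hG.exists_walk_length_eq_dist w v
  obtain ⟨r, hr⟩ := exists_walk_lt G S u v hcut hv w v q rfl hw
  have := SimpleGraph.dist_le r
  omega

lemma mostarPsi_of_cut {V : Type*} [Fintype V] (G : SimpleGraph V) (hG : G.Connected)
    (S : V → Prop) (u v : V) (hu : S u) (hv : ¬ S v)
    (hcut : ∀ x y, G.Adj x y → S x → ¬ S y → x = u ∧ y = v) :
    mostarPsi G s(u, v) =
      (2 * ((Finset.univ.filter S).card : ℤ) - Fintype.card V).natAbs := by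
  have h1 : ∀ w, S w → G.dist w u < G.dist w v :=
    dist_lt_of_cut G hG S u v (fun x y h hx hy => (hcut x y h hx hy).1) hv
  have h2 : ∀ w, ¬ S w → G.dist w v < G.dist w u :=
    dist_lt_of_cut G hG (fun w => ¬ S w) v u
      (fun x y h hx hy => (hcut y x h.symm (not_not.mp hy) hx).2) (not_not.mpr hu)
  have e1 : (Finset.univ.filter fun w => G.dist w u < G.dist w v) = Finset.univ.filter S := by
    ext w
    by_cases h : S w
    · simp [h, h1 w h]
    · simp [h, (h2 w h).le]
  have e2 : (Finset.univ.filter fun w => G.dist w v < G.dist w u)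
      = Finset.univ.filter (fun w => ¬ S w) := by
    ext w
    by_cases h : S w
    · simp [h, (h1 w h).le]
    · simp [h, h2 w h]
  have e3 := Finset.card_filter_add_card_filter_not (s := (Finset.univ : Finset V)) S
  rw [Finset.card_univ] at e3
  simp only [mostarPsi, Sym2.lift_mk, e1, e2]
  omega

lemma parentGraph_connected (n : ℕ) (p : ℕ → ℕ) (hn : 0 < n)
    (hp : ∀ v, 0 < v → v < n → p v < v) : (parentGraph n p).Connected := by
  have key : ∀ v (h : v < n), (parentGraph n p).Reachable ⟨v, h⟩ ⟨0, hn⟩ := by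
    intro v
    induction v using Nat.strong_induction_on with
    | _ v ih =>
      intro h
      rcases Nat.eq_zero_or_pos v with rfl | hv
      · exact SimpleGraph.Reachable.refl _
      · have hlt := hp v hv h
        refine SimpleGraph.Reachable.trans (SimpleGraph.Adj.reachable ?_)
          (ih (p v) hlt (hlt.trans h))
        simp only [parentGraph, SimpleGraph.fromRel_adj]
        refine ⟨?_, Or.inl trivial⟩
        intro e
        have := congrArg Fin.val e
        simp at this
        omega
  have : Nonempty (Fin n) := ⟨⟨0, hn⟩⟩
  exact SimpleGraph.Connected.mk fun x y => (key x x.2).trans (key y y.2).symm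

lemma mostar_parentGraph (n : ℕ) (p : ℕ → ℕ) (hn : 0 < n) (hp0 : p 0 = 0)
    (hp : ∀ v, 0 < v → v < n → p v < v) (S : ℕ → ℕ → Prop)
    (hS : ∀ v, 0 < v → v < n → S v v) (hS' : ∀ v, 0 < v → v < n → ¬ S v (p v))
    (hSx : ∀ v x, 0 < v → v < n → 0 < x → x < n → x ≠ v → (S v x ↔ S v (p x))) :
    mostar (parentGraph n p) = ∑ v ∈ Finset.Ico 1 n,
      (2 * (((Finset.range n).filter (S v)).card : ℤ) - n).natAbs := by
  symm
  have hn' : ∀ v, p (v % n) < n := by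
    intro v
    have h2 := Nat.mod_lt v hn
    rcases Nat.eq_zero_or_pos (v % n) with h | h
    · rw [h, hp0]; exact hn
    · exact (hp _ h h2).trans h2
  let f : ℕ → Sym2 (Fin n) := fun v => s(⟨v % n, Nat.mod_lt v hn⟩, ⟨p (v % n), hn' v⟩)
  unfold mostar
  refine Finset.sum_bij (fun v _ => f v) ?_ ?_ ?_ ?_
  · intro v hv
    rw [Finset.mem_Ico] at hv
    have := hp v hv.1 hv.2
    simp only [f]
    rw [SimpleGraph.mem_edgeFinset, SimpleGraph.mem_edgeSet]
    simp only [parentGraph, SimpleGraph.fromRel_adj, Nat.mod_eq_of_lt hv.2, ne_eq, Fin.mk.injEq]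
    exact ⟨by omega, Or.inl trivial⟩
  · intro v hv w hw h
    rw [Finset.mem_Ico] at hv hw
    have := hp v hv.1 hv.2
    have := hp w hw.1 hw.2
    simp only [f, Nat.mod_eq_of_lt hv.2, Nat.mod_eq_of_lt hw.2, Sym2.eq_iff, Fin.mk.injEq] at h
    omega
  · intro e
    induction e using Sym2.ind with
    | _ x y =>
      intro h
      rw [SimpleGraph.mem_edgeFinset, SimpleGraph.mem_edgeSet] at h
      simp only [parentGraph, SimpleGraph.fromRel_adj] at h
      obtain ⟨hne, h⟩ := h
      have hne' : x.val ≠ y.val := fun h => hne (Fin.ext h)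
      rcases h with h | h
      · have hx : 0 < x.val := by
          rcases Nat.eq_zero_or_pos x.val with h0 | h0
          · rw [h0, hp0] at h; omega
          · exact h0
        refine ⟨x, Finset.mem_Ico.2 ⟨hx, x.2⟩, ?_⟩
        simp [f, Nat.mod_eq_of_lt x.2, h]
      · have hy : 0 < y.val := by
          rcases Nat.eq_zero_or_pos y.val with h0 | h0
          · rw [h0, hp0] at h; omega
          · exact h0
        refine ⟨y, Finset.mem_Ico.2 ⟨hy, y.2⟩, ?_⟩
        simp [f, Nat.mod_eq_of_lt y.2, h, Sym2.eq_swap]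
  · intro v hv
    rw [Finset.mem_Ico] at hv
    obtain ⟨hv1, hv2⟩ := hv
    have hpv := hp v hv1 hv2
    have hcut : ∀ x y : Fin n, (parentGraph n p).Adj x y → S v x → ¬ S v y →
        x.val = v ∧ y.val = p v := by
      intro x y hadj hx hy
      simp only [parentGraph, SimpleGraph.fromRel_adj] at hadj
      obtain ⟨hne, h⟩ := hadj
      have hne' : x.val ≠ y.val := fun h => hne (Fin.ext h)
      rcases h with h | h
      · have hx0 : 0 < x.val := by
          rcases Nat.eq_zero_or_pos x.val with h0 | h0
          · rw [h0, hp0] at h; omega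
          · exact h0
        by_cases hxv : x.val = v
        · exact ⟨hxv, by rw [← h, hxv]⟩
        · have := (hSx v x hv1 hv2 hx0 x.2 hxv).1 hx
          rw [h] at this
          exact absurd this hy
      · have hy0 : 0 < y.val := by
          rcases Nat.eq_zero_or_pos y.val with h0 | h0
          · rw [h0, hp0] at h; omega
          · exact h0
        by_cases hyv : y.val = v
        · rw [hyv] at hy
          exact absurd (hS v hv1 hv2) hy
        · have := (hSx v y hv1 hv2 hy0 y.2 hyv).2 (by rw [h]; exact hx)
          exact absurd this hy
    have hps := mostarPsi_of_cut (parentGraph n p) (parentGraph_connected n p hn hp)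
      (fun w => S v w.val) ⟨v, hv2⟩ ⟨p v, hpv.trans hv2⟩ (hS v hv1 hv2) (hS' v hv1 hv2)
      (fun x y h hx hy => ⟨Fin.ext (hcut x y h hx hy).1, Fin.ext (hcut x y h hx hy).2⟩)
    have hcard : (Finset.univ.filter fun w : Fin n => S v w.val).card
        = ((Finset.range n).filter (S v)).card := by
      refine Finset.card_bij (fun w _ => w.val) ?_ ?_ ?_
      · intro w hw
        simpa using hw
      · intro x _ y _ h
        exact Fin.ext h
      · intro w hw
        simp only [Finset.mem_filter, Finset.mem_range] at hw
        exact ⟨⟨w, hw.1⟩, by simpa using hw.2, rfl⟩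
    simp only [f, Nat.mod_eq_of_lt hv2]
    rw [hps, hcard, Fintype.card_fin]

/-- Value of an edge, in terms of its lower vertex. -/
def gF (n a b v : ℕ) : ℕ :=
  if v < n - a - b - 2 then
    if v = 1 then n - 2 else
    (2 * (((n - a - b - 2 - v) + (n - b - (n - a - b - 2 + v)) +
      (n - max (n - b) (v + a + b + 3)) : ℕ) : ℤ) - n).natAbs
  else n - 2

lemma mostar_catF (n a b : ℕ) (hn : 2 * (a + b) + 5 ≤ n) :
    mostar (catF n a b) = ∑ v ∈ Finset.Ico 1 n, gF n a b v := by
  unfold catF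
  set p : ℕ → ℕ := fun v =>
    if v < n - a - b - 2 then v - 1
    else if v = n - a - b - 2 then 1
    else if v < n - b then v - (n - a - b - 2)
    else v - a - b - 3 with hpdef
  have hpL : ∀ x, x < n → n - a - b - 2 ≤ x → 0 < p x ∧ p x < n - a - b - 2 := by
    intro x hx hx2
    simp only [hpdef]
    split_ifs <;> omega
  have hpP : ∀ x, x < n - a - b - 2 → p x = x - 1 := by
    intro x hx
    simp only [hpdef, if_pos hx]
  obtain ⟨S, hSd⟩ : ∃ S : ℕ → ℕ → Prop, S = fun v w =>
    if v < n - a - b - 2 then v ≤ (if w < n - a - b - 2 then w else p w) else w = v := ⟨_, rfl⟩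
  rw [mostar_parentGraph n p (by omega) (by rw [hpP 0 (by omega)]) ?_ S ?_ ?_ ?_]
  · refine Finset.sum_congr rfl fun v hv => ?_
    rw [Finset.mem_Ico] at hv
    unfold gF
    split_ifs with h1 h2
    · have : (Finset.range n).filter (S v) = Finset.Ico 1 n := by
        ext w
        simp only [Finset.mem_filter, Finset.mem_range, Finset.mem_Ico, hSd, if_pos h1]
        by_cases hw : w < n - a - b - 2
        · simp only [if_pos hw]; omega
        · simp only [if_neg hw]
          constructor
          · rintro ⟨h, -⟩; omega
          · rintro ⟨-, h⟩
            have := hpL w h (by omega)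
            omega
      rw [this, Nat.card_Ico]; omega
    · have : (Finset.range n).filter (S v) =
          (Finset.Ico v (n - a - b - 2) ∪ Finset.Ico (n - a - b - 2 + v) (n - b)) ∪
            Finset.Ico (max (n - b) (v + a + b + 3)) n := by
        ext w
        simp only [Finset.mem_filter, Finset.mem_range, Finset.mem_Ico, hSd, if_pos h1,
          Finset.mem_union, hpdef]
        split_ifs <;> omega
      rw [this, Finset.card_union_of_disjoint, Finset.card_union_of_disjoint, Nat.card_Ico,
        Nat.card_Ico, Nat.card_Ico]
      · rw [Finset.disjoint_left]; intro w; simp only [Finset.mem_Ico]; omega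
      · rw [Finset.disjoint_left]; intro w
        simp only [Finset.mem_Ico, Finset.mem_union]; omega
    · have : (Finset.range n).filter (S v) = {v} := by
        ext w
        simp only [Finset.mem_filter, Finset.mem_range, hSd, if_neg h1, Finset.mem_singleton]
        omega
      rw [this, Finset.card_singleton]; omega
  · intro v h1 h2
    by_cases h : v < n - a - b - 2
    · rw [hpP v h]; omega
    · have := hpL v h2 (by omega); omega
  · intro v h1 h2
    simp only [hSd]
    split_ifs <;> omega
  · intro v h1 h2
    simp only [hSd]
    by_cases h : v < n - a - b - 2
    · have h' : v - 1 < n - a - b - 2 := by omega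
      simp only [if_pos h, hpP v h, if_pos h']; omega
    · have := hpL v h2 (by omega)
      simp only [if_neg h]; omega
  · intro v x h1 h2 h3 h4 h5
    simp only [hSd]
    by_cases hx : x < n - a - b - 2
    · have h' : x - 1 < n - a - b - 2 := by omega
      simp only [hpP x hx, if_pos hx, if_pos h']
      split_ifs <;> omega
    · have := hpL x h4 (by omega)
      simp only [if_neg hx, if_pos this.2]
      split_ifs <;> omega

lemma telescope_nat (h : ℕ → ℕ) (s t : ℕ) (hst : s ≤ t) :
    ∑ v ∈ Finset.Ico s t, h (v + 1) + h s = ∑ v ∈ Finset.Ico s t, h v + h t := by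
  induction t, hst using Nat.le_induction with
  | base => simp
  | succ t hst ih =>
    rw [Finset.sum_Ico_succ_top hst, Finset.sum_Ico_succ_top hst]
    omega

lemma gF_left (n a b v : ℕ) (hn : 2 * (a + b) + 5 ≤ n) (h1 : 2 ≤ v) (h2 : v ≤ a + 2)
    (h3 : v + b + 1 ≤ n - a - b - 2) :
    gF n a b v = ((n : ℤ) - 4 * v).natAbs := by
  have e : max (n - b) (v + a + b + 3) = n - b := max_eq_left (by omega)
  rw [gF, if_pos (by omega), if_neg (by omega), e]
  have : (n - a - b - 2 - v) + (n - b - (n - a - b - 2 + v)) + (n - (n - b)) + 2 * v = n := by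
    omega
  omega

lemma gF_mid (n a b v : ℕ) (hn : 2 * (a + b) + 5 ≤ n) (h1 : 2 ≤ v) (h2 : a + 2 ≤ v)
    (h3 : v + b + 1 ≤ n - a - b - 2) :
    gF n a b v = ((n : ℤ) - 2 * (v + a + 2)).natAbs := by
  have e : max (n - b) (v + a + b + 3) = n - b := max_eq_left (by omega)
  rw [gF, if_pos (by omega), if_neg (by omega), e]
  have : (n - a - b - 2 - v) + (n - b - (n - a - b - 2 + v)) + (n - (n - b)) + (v + a + 2)
      = n := by
    omega
  omega

lemma gF_right (n a b v : ℕ) (hn : 2 * (a + b) + 5 ≤ n) (h1 : 2 ≤ v) (h2 : a + 2 ≤ v)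
    (h3 : v < n - a - b - 2) (h4 : n - a - b - 2 ≤ v + b + 1) :
    gF n a b v = ((n : ℤ) - 2 * (2 * v + 2 * a + 2 * b + 5 - n)).natAbs := by
  have e : max (n - b) (v + a + b + 3) = v + a + b + 3 := max_eq_right (by omega)
  rw [gF, if_pos h3, if_neg (by omega), e]
  have : (n - a - b - 2 - v) + (n - b - (n - a - b - 2 + v)) + (n - (v + a + b + 3))
      + (2 * v + 2 * a + 2 * b + 5) = 2 * n := by
    omega
  omega

lemma gF_one (n a b v : ℕ) (h : v = 1 ∨ n - a - b - 2 ≤ v) : gF n a b v = n - 2 := by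
  unfold gF
  split_ifs with h1 h2
  · rfl
  · omega
  · rfl

/-- for a ≥ b ≥ 1 and 2(a+b) < n-5, Mo(F_{n,a-1,b+1}) < Mo(F_{n,a,b}). -/
theorem mostar_catF_lt (n a b : ℕ) (hb : 1 ≤ b) (hab : b ≤ a)
    (hn : 2 * (a + b) < n - 5) :
    mostar (catF n (a - 1) (b + 1)) < mostar (catF n a b) := by
  rw [mostar_catF n a b (by omega), mostar_catF n (a - 1) (b + 1) (by omega)]
  let h : ℕ → ℕ := fun j => ((n : ℤ) - 2 * (j + a + 1)).natAbs
  have split : ∀ g : ℕ → ℕ, ∑ v ∈ Finset.Ico 1 n, g v =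
      ∑ v ∈ Finset.Ico 1 (a + 2), g v +
      ∑ v ∈ Finset.Ico (a + 2) (n - a - 2 * b - 3), g v +
      ∑ v ∈ Finset.Ico (n - a - 2 * b - 3) n, g v := by
    intro g
    rw [Finset.sum_Ico_consecutive _ (by omega) (by omega),
      Finset.sum_Ico_consecutive _ (by omega) (by omega)]
  rw [split, split]
  have e1 : ∑ v ∈ Finset.Ico 1 (a + 2), gF n (a - 1) (b + 1) v =
      ∑ v ∈ Finset.Ico 1 (a + 2), gF n a b v := by
    refine Finset.sum_congr rfl fun v hv => ?_
    rw [Finset.mem_Ico] at hv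
    rcases Nat.lt_or_ge v 2 with h1 | h1
    · rw [gF_one _ _ _ _ (by omega), gF_one _ _ _ _ (by omega)]
    · rw [gF_left n a b v (by omega) h1 (by omega) (by omega)]
      rcases Nat.lt_or_ge (a + 1) v with h2 | h2
      · omega
      · rw [gF_left n (a - 1) (b + 1) v (by omega) h1 (by omega) (by omega)]
  have e3 : ∑ v ∈ Finset.Ico (n - a - 2 * b - 3) n, gF n (a - 1) (b + 1) v =
      ∑ v ∈ Finset.Ico (n - a - 2 * b - 3) n, gF n a b v := by
    refine Finset.sum_congr rfl fun v hv => ?_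
    rw [Finset.mem_Ico] at hv
    rcases Nat.lt_or_ge v (n - a - b - 2) with h1 | h1
    · rw [gF_right n a b v (by omega) (by omega) (by omega) h1 (by omega),
        gF_right n (a - 1) (b + 1) v (by omega) (by omega) (by omega) (by omega) (by omega)]
      omega
    · rw [gF_one _ _ _ _ (by omega), gF_one _ _ _ _ (by omega)]
  have e2 : ∑ v ∈ Finset.Ico (a + 2) (n - a - 2 * b - 3), gF n (a - 1) (b + 1) v =
      ∑ v ∈ Finset.Ico (a + 2) (n - a - 2 * b - 3), h v := by
    refine Finset.sum_congr rfl fun v hv => ?_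
    rw [Finset.mem_Ico] at hv
    rw [gF_mid n (a - 1) (b + 1) v (by omega) (by omega) (by omega) (by omega)]
    simp only [h]
    omega
  have e2' : ∑ v ∈ Finset.Ico (a + 2) (n - a - 2 * b - 3), gF n a b v =
      ∑ v ∈ Finset.Ico (a + 2) (n - a - 2 * b - 3), h (v + 1) := by
    refine Finset.sum_congr rfl fun v hv => ?_
    rw [Finset.mem_Ico] at hv
    rw [gF_mid n a b v (by omega) (by omega) (by omega) (by omega)]
    simp only [h]
    omega
  have ht := telescope_nat h (a + 2) (n - a - 2 * b - 3) (by omega)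
  have hlt : h (a + 2) < h (n - a - 2 * b - 3) := by
    simp only [h]
    omega
  rw [e1, e2, e2', e3]
  omega
end

section
/- Let n and t be integers with 0 ≤ t ≤ n−4 and n−t = 5, and let T be a tree of order n with exactly t vertices of degree two that has the minimum Mostar index among all such trees. Then T is isomorphic to F_{n,0,0}. -/
open Finset SimpleGraph

open scoped Classical

/-! ### Isomorphism invariance -/

theorem iso_dist_le {V W : Type} {G : SimpleGraph V} {H : SimpleGraph W} (f : G ≃g H)
    (hG : G.Connected) (u v : V) : H.dist (f u) (f v) ≤ G.dist u v := by
  obtain ⟨p, hp⟩ := hG.exists_walk_length_eq_dist u v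
  rw [← hp]
  have := SimpleGraph.dist_le (p.map f.toHom)
  simpa using this

theorem iso_dist {V W : Type} {G : SimpleGraph V} {H : SimpleGraph W} (f : G ≃g H)
    (hG : G.Connected) (u v : V) : H.dist (f u) (f v) = G.dist u v := by
  refine le_antisymm (iso_dist_le f hG u v) ?_
  have := iso_dist_le f.symm (f.connected_iff.1 hG) (f u) (f v)
  simpa using this

theorem iso_mostar {V W : Type} [Fintype V] [Fintype W] {G : SimpleGraph V} {H : SimpleGraph W}
    (f : G ≃g H) (hG : G.Connected) : mostar G = mostar H := by
  unfold mostar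
  refine Finset.sum_bij (fun e _ => Sym2.map f e) ?_ ?_ ?_ ?_
  · intro e
    induction e with | _ u v =>
    simp only [SimpleGraph.mem_edgeFinset, SimpleGraph.mem_edgeSet, Sym2.map_mk]
    exact fun h => f.map_rel_iff.2 h
  · intro e _ e' _ h
    exact Sym2.map.injective f.injective h
  · intro e
    induction e with | _ u v =>
    intro h
    refine ⟨s(f.symm u, f.symm v), ?_, by simp⟩
    simp only [SimpleGraph.mem_edgeFinset, SimpleGraph.mem_edgeSet] at h ⊢
    exact f.symm.map_rel_iff.2 h
  · intro e _
    induction e with | _ u v =>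
    have key : ∀ u v : V, (Finset.univ.filter fun w => G.dist w u < G.dist w v).card =
        (Finset.univ.filter fun w => H.dist w (f u) < H.dist w (f v)).card := by
      intro u v
      refine Finset.card_bij (fun w _ => f w) ?_ ?_ ?_
      · intro w hw
        simpa [iso_dist f hG] using hw
      · intro a _ b _ h
        exact f.injective h
      · intro w hw
        refine ⟨f.symm w, ?_, by simp⟩
        simp only [Finset.mem_filter, Finset.mem_univ, true_and] at hw ⊢
        rw [← iso_dist f hG, ← iso_dist f hG]
        simpa using hw
    simp only [mostarPsi, Sym2.map_mk, Sym2.lift_mk]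
    rw [key u v, key v u]

theorem iso_degreeTwoCount {V W : Type} [Fintype V] [Fintype W] {G : SimpleGraph V}
    {H : SimpleGraph W} (f : G ≃g H) : degreeTwoCount G = degreeTwoCount H := by
  unfold degreeTwoCount
  refine Finset.card_bij (fun w _ => f w) ?_ ?_ ?_
  · intro w hw
    simp only [Finset.mem_filter, Finset.mem_univ, true_and] at hw ⊢
    rw [← hw]
    exact f.degree_eq w
  · intro a _ b _ h
    exact f.injective h
  · intro w hw
    refine ⟨f.symm w, ?_, by simp⟩
    simp only [Finset.mem_filter, Finset.mem_univ, true_and] at hw ⊢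
    rw [← hw]
    exact f.symm.degree_eq w

/-! ### Cuts -/

theorem walk_cut {V : Type} {G : SimpleGraph V} (hG : G.Connected) (S : Set V) (u : V)
    (hcut : ∀ a b, G.Adj a b → a ∈ S → b ∉ S → a = u) {w x : V} (p : G.Walk w x) :
    w ∈ S → x ∉ S → G.dist w u < p.length := by
  induction p with
  | nil => intro h h'; exact absurd h h'
  | @cons a b c hab q ih =>
    intro ha hc
    by_cases hb : b ∈ S
    · have h1 := ih hb hc
      have h2 : G.dist a u ≤ G.dist a b + G.dist b u := hG.dist_triangle
      have h3 : G.dist a b = 1 := SimpleGraph.dist_eq_one_iff_adj.2 hab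
      simp only [SimpleGraph.Walk.length_cons]
      omega
    · have := hcut a b hab ha hb
      subst this
      simp

theorem dist_cut {V : Type} {G : SimpleGraph V} (hG : G.Connected) (S : Set V) (u v : V)
    (hv : v ∉ S)
    (hcut : ∀ a b, G.Adj a b → a ∈ S → b ∉ S → a = u) {w : V} (hw : w ∈ S) :
    G.dist w u < G.dist w v := by
  obtain ⟨p, hp⟩ := hG.exists_walk_length_eq_dist w v
  rw [← hp]
  exact walk_cut hG S u hcut p hw hv

theorem psi_cut {V : Type} [Fintype V] {G : SimpleGraph V} (hG : G.Connected) (S : Finset V)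
    (u v : V) (hu : u ∈ S) (hv : v ∉ S)
    (hcut : ∀ a b, G.Adj a b → a ∈ S → b ∉ S → a = u ∧ b = v) :
    mostarPsi G s(u, v) = (2 * (S.card : ℤ) - Fintype.card V).natAbs := by
  have h1 : ∀ w ∈ S, G.dist w u < G.dist w v := fun w hw =>
    dist_cut hG (S : Set V) u v (by simpa using hv)
      (fun a b h ha hb => (hcut a b h (by simpa using ha) (by simpa using hb)).1) (by simpa using hw)
  have h2 : ∀ w ∉ S, G.dist w v < G.dist w u := fun w hw =>
    dist_cut hG ((S : Set V)ᶜ) v u (by simpa using hu)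
      (fun a b h ha hb => (hcut b a h.symm (by simpa using hb) (by simpa using ha)).2)
        (by simpa using hw)
  have e1 : (Finset.univ.filter fun w => G.dist w u < G.dist w v) = S := by
    ext w
    simp only [Finset.mem_filter, Finset.mem_univ, true_and]
    refine ⟨fun h => ?_, h1 w⟩
    by_contra hw
    exact absurd (h2 w hw) (by omega)
  have e2 : (Finset.univ.filter fun w => G.dist w v < G.dist w u) = Sᶜ := by
    ext w
    simp only [Finset.mem_filter, Finset.mem_univ, true_and, Finset.mem_compl]
    refine ⟨fun h hw => ?_, h2 w⟩
    exact absurd (h1 w hw) (by omega)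
  simp only [mostarPsi, Sym2.lift_mk]
  rw [e1, e2]
  have := Finset.card_add_card_compl S
  omega

/-! ### Graphs given by a parent function -/

def parG {V : Type} (q : V → V) : SimpleGraph V := SimpleGraph.fromRel (fun u v => q u = v)

theorem parG_adj {V : Type} (q : V → V) (u v : V) :
    (parG q).Adj u v ↔ u ≠ v ∧ (q u = v ∨ q v = u) := by
  simp [parG]

theorem parG_connected {V : Type} (q : V → V) (r : V) (d : V → ℕ)
    (hd : ∀ v, v ≠ r → d (q v) < d v) : (parG q).Connected := by
  have h : ∀ k v, d v = k → (parG q).Reachable v r := by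
    intro k
    induction k using Nat.strong_induction_on with
    | _ k ih =>
      intro v hv
      by_cases hr : v = r
      · subst hr; exact SimpleGraph.Reachable.refl _
      · have h1 := hd v hr
        have hne : v ≠ q v := fun h => by rw [← h] at h1; omega
        have h2 : (parG q).Adj v (q v) := (parG_adj q _ _).2 ⟨hne, Or.inl rfl⟩
        exact h2.reachable.trans (ih _ (by omega) (q v) rfl)
  have : Nonempty V := ⟨r⟩
  exact ⟨fun u v => (h _ u rfl).trans (h _ v rfl).symm⟩

theorem parG_injOn {V : Type} [Fintype V] (q : V → V) (r : V) (d : V → ℕ)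
    (hd : ∀ v, v ≠ r → d (q v) < d v) :
    Set.InjOn (fun v => s(v, q v)) ((Finset.univ.erase r : Finset V) : Set V) := by
  intro a ha b hb h
  have ha := hd a (by simpa using ha)
  have hb := hd b (by simpa using hb)
  simp only [Sym2.eq_iff] at h
  rcases h with h | h
  · exact h.1
  · rw [h.2, ] at ha
    rw [← h.1] at hb
    omega

theorem parG_edgeFinset {V : Type} [Fintype V] (q : V → V) (r : V) (d : V → ℕ) (hr : q r = r)
    (hd : ∀ v, v ≠ r → d (q v) < d v) :
    (parG q).edgeFinset = (Finset.univ.erase r).image (fun v => s(v, q v)) := by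
  ext e
  induction e with | _ u v =>
  simp only [SimpleGraph.mem_edgeFinset, SimpleGraph.mem_edgeSet, parG_adj, Finset.mem_image,
    Finset.mem_erase, Finset.mem_univ, and_true, Sym2.eq_iff]
  constructor
  · rintro ⟨h, rfl | rfl⟩
    · exact ⟨u, fun h' => h (by rw [h', hr]), Or.inl ⟨rfl, rfl⟩⟩
    · exact ⟨v, fun h' => h (by rw [h', hr]), Or.inr ⟨rfl, rfl⟩⟩
  · rintro ⟨a, ha, ⟨rfl, rfl⟩ | ⟨rfl, rfl⟩⟩
    · exact ⟨fun h => by have := hd _ ha; rw [← h] at this; omega, Or.inl rfl⟩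
    · exact ⟨fun h => by have := hd _ ha; rw [h] at this; omega, Or.inr rfl⟩

theorem parG_isTree {V : Type} [Fintype V] (q : V → V) (r : V) (d : V → ℕ) (hr : q r = r)
    (hd : ∀ v, v ≠ r → d (q v) < d v) : (parG q).IsTree := by
  rw [SimpleGraph.isTree_iff_connected_and_card]
  refine ⟨parG_connected q r d hd, ?_⟩
  rw [Nat.card_eq_fintype_card, ← SimpleGraph.edgeFinset_card, parG_edgeFinset q r d hr hd,
    Finset.card_image_of_injOn (parG_injOn q r d hd), Finset.card_erase_of_mem (Finset.mem_univ _),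
    Nat.card_eq_fintype_card, Finset.card_univ]
  have : 0 < Fintype.card V := Fintype.card_pos_iff.2 ⟨r⟩
  omega

/-- Every finite tree comes from a parent function, given by distance from a root. -/
theorem tree_parG {V : Type} [Fintype V] (G : SimpleGraph V) (hG : G.IsTree) (r : V) :
    ∃ q : V → V, q r = r ∧ (∀ v, v ≠ r → G.dist r (q v) + 1 = G.dist r v) ∧ G = parG q := by
  have hc : G.Connected := hG.connected
  have h1 : ∀ v, ∃ w, (v = r → w = r) ∧ (v ≠ r → G.Adj v w ∧ G.dist r w + 1 = G.dist r v) := by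
    intro v
    by_cases hv : v = r
    · exact ⟨r, fun _ => rfl, fun h => absurd hv h⟩
    · obtain ⟨p, hp⟩ := hc.exists_walk_length_eq_dist v r
      cases p with
      | nil => exact absurd rfl hv
      | @cons _ b _ hab p' =>
        refine ⟨b, fun h => absurd h hv, fun _ => ⟨hab, ?_⟩⟩
        have h2 := SimpleGraph.dist_le p'
        have h3 : G.dist v r ≤ G.dist v b + G.dist b r := hc.dist_triangle
        have h4 : G.dist v b = 1 := SimpleGraph.dist_eq_one_iff_adj.2 hab
        rw [SimpleGraph.Walk.length_cons] at hp
        rw [SimpleGraph.dist_comm, SimpleGraph.dist_comm (u := r)]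
        omega
  choose q hq1 hq2 using h1
  have hd : ∀ v, v ≠ r → G.dist r (q v) < G.dist r v := fun v hv => by
    have := (hq2 v hv).2; omega
  refine ⟨q, hq1 r rfl, fun v hv => (hq2 v hv).2, ?_⟩
  have hsub : (parG q).edgeFinset ⊆ G.edgeFinset := by
    rw [parG_edgeFinset q r (fun v => G.dist r v) (hq1 r rfl) hd]
    intro e he
    simp only [Finset.mem_image, Finset.mem_erase, Finset.mem_univ, and_true] at he
    obtain ⟨a, ha, rfl⟩ := he
    simpa using (hq2 a ha).1
  have hcard := hG.card_edgeFinset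
  have hcard2 := (parG_isTree q r (fun v => G.dist r v) (hq1 r rfl) hd).card_edgeFinset
  have := Finset.eq_of_subset_of_card_le hsub (by omega)
  exact (SimpleGraph.edgeFinset_inj.1 this).symm

theorem parG_mostar {V : Type} [Fintype V] (q : V → V) (r : V) (d : V → ℕ) (hr : q r = r)
    (hd : ∀ v, v ≠ r → d (q v) < d v) (S : Finset V) (hS : ∀ v, v ∈ S ↔ v ≠ r) :
    mostar (parG q) = ∑ v ∈ S, mostarPsi (parG q) s(v, q v) := by
  have : S = Finset.univ.erase r := by
    ext v; simp [hS]
  rw [this]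
  unfold mostar
  rw [parG_edgeFinset q r d hr hd, Finset.sum_image (parG_injOn q r d hd)]

/-! ### Spiders with four legs -/

abbrev SpV (l : Fin 4 → ℕ) : Type := Option (Σ i : Fin 4, Fin (l i))

def spPar (l : Fin 4 → ℕ) : SpV l → SpV l
  | none => none
  | some ⟨i, j⟩ => if j.val = 0 then none else some ⟨i, ⟨j.val - 1, by omega⟩⟩

def spRank (l : Fin 4 → ℕ) : SpV l → ℕ
  | none => 0
  | some ⟨_, j⟩ => j.val + 1

abbrev Sp (l : Fin 4 → ℕ) : SimpleGraph (SpV l) := parG (spPar l)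

theorem spRank_par (l : Fin 4 → ℕ) (v : SpV l) (hv : v ≠ none) :
    spRank l (spPar l v) < spRank l v := by
  rcases v with _ | ⟨i, j⟩
  · exact absurd rfl hv
  · by_cases h : j.val = 0
    · simp [spPar, spRank, h]
    · simp only [spPar, if_neg h]
      change j.val - 1 + 1 < j.val + 1; omega

theorem sp_isTree (l : Fin 4 → ℕ) : (Sp l).IsTree :=
  parG_isTree (spPar l) none (spRank l) rfl (spRank_par l)

theorem sp_card (l : Fin 4 → ℕ) : Fintype.card (SpV l) = ∑ i, l i + 1 := by
  simp

theorem sp_adj_some (l : Fin 4 → ℕ) (i i' : Fin 4) (j : Fin (l i)) (j' : Fin (l i')) :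
    (Sp l).Adj (some ⟨i, j⟩) (some ⟨i', j'⟩) ↔
      i = i' ∧ (j.val + 1 = j'.val ∨ j'.val + 1 = j.val) := by
  rw [parG_adj]
  have key : ∀ (i i' : Fin 4) (j : Fin (l i)) (j' : Fin (l i')),
      spPar l (some ⟨i, j⟩) = some ⟨i', j'⟩ ↔ i = i' ∧ j'.val + 1 = j.val := by
    intro i i' j j'
    simp only [spPar]
    split
    · simp; omega
    · constructor
      · intro h
        simp only [Option.some.injEq, Sigma.mk.injEq] at h
        obtain ⟨rfl, h⟩ := h
        have := eq_of_heq h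
        subst this
        simp; omega
      · rintro ⟨rfl, h⟩
        simp only [Option.some.injEq, Sigma.mk.injEq, heq_eq_eq, true_and]
        ext
        simp; omega
  rw [key, key]
  constructor
  · rintro ⟨_, ⟨h, h'⟩ | ⟨h, h'⟩⟩
    · exact ⟨h, Or.inr h'⟩
    · exact ⟨h.symm, Or.inl h'⟩
  · rintro ⟨rfl, h⟩
    refine ⟨?_, by tauto⟩
    rintro h'
    simp only [Option.some.injEq, Sigma.mk.injEq, heq_eq_eq, true_and] at h'
    subst h'
    omega

theorem sp_adj_none (l : Fin 4 → ℕ) (i : Fin 4) (j : Fin (l i)) :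
    (Sp l).Adj none (some ⟨i, j⟩) ↔ j.val = 0 := by
  rw [parG_adj]
  simp [spPar]

theorem sp_psi (l : Fin 4 → ℕ) (i : Fin 4) (j : Fin (l i)) :
    mostarPsi (Sp l) s(some ⟨i, j⟩, spPar l (some ⟨i, j⟩)) =
      (2 * ((l i - j.val : ℕ) : ℤ) - (∑ i, l i + 1 : ℕ)).natAbs := by
  let f : Fin (l i) → SpV l := fun k => some ⟨i, k⟩
  have hf : Function.Injective f := by
    intro a b h
    simpa [f] using h
  have hcard : ((Finset.Ici j).image f).card = l i - j.val := by
    rw [Finset.card_image_of_injective _ hf, Fin.card_Ici]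
  have hmem : ∀ i' (j' : Fin (l i')), (some ⟨i', j'⟩ : SpV l) ∈ (Finset.Ici j).image f ↔
      i' = i ∧ j.val ≤ j'.val := by
    intro i' j'
    simp only [Finset.mem_image, Finset.mem_Ici, f]
    constructor
    · rintro ⟨a, ha, h⟩
      simp only [Option.some.injEq, Sigma.mk.injEq] at h
      obtain ⟨rfl, h⟩ := h
      have := eq_of_heq h
      subst this
      exact ⟨rfl, ha⟩
    · rintro ⟨rfl, h⟩
      exact ⟨j', h, rfl⟩
  have hnone : (none : SpV l) ∉ (Finset.Ici j).image f := by simp [f]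
  rw [psi_cut (sp_isTree l).connected ((Finset.Ici j).image f), hcard, sp_card]
  · rw [hmem]; simp
  · simp only [spPar]
    split
    · exact hnone
    · rw [hmem]; simp; omega
  · intro a b hab ha hb
    rcases a with _ | ⟨i', j'⟩
    · exact absurd ha hnone
    obtain ⟨rfl, hj⟩ := (hmem _ _).1 ha
    rcases b with _ | ⟨i'', j''⟩
    · have h0 := (sp_adj_none l _ _).1 hab.symm
      have : j' = j := by ext; omega
      subst this
      simp [spPar, h0]
    · obtain ⟨rfl, h⟩ := (sp_adj_some l _ _ _ _).1 hab
      have h2 : ¬ (j.val ≤ j''.val) := fun h => hb ((hmem _ _).2 ⟨rfl, h⟩)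
      have : j' = j := by ext; omega
      subst this
      have h3 : j'.val ≠ 0 := by omega
      refine ⟨rfl, ?_⟩
      simp only [spPar, h3, if_false, Option.some.injEq, Sigma.mk.injEq, heq_eq_eq, true_and]
      ext
      simp; omega

def legSum (n k : ℕ) : ℕ := ∑ j ∈ Finset.range k, (2 * ((j + 1 : ℕ) : ℤ) - n).natAbs

theorem sp_mostar (l : Fin 4 → ℕ) :
    mostar (Sp l) = ∑ i, legSum (∑ i, l i + 1) (l i) := by
  rw [parG_mostar (spPar l) none (spRank l) rfl (spRank_par l)
    ((Finset.univ : Finset (Σ i : Fin 4, Fin (l i))).map Function.Embedding.some)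
    (by intro x; rcases x with _ | x <;> simp)]
  rw [Finset.sum_map, Fintype.sum_sigma]
  refine Finset.sum_congr rfl fun i _ => ?_
  have h2 : ∀ j : Fin (l i), mostarPsi (parG (spPar l))
      s(Function.Embedding.some ⟨i, j⟩, spPar l (Function.Embedding.some ⟨i, j⟩)) =
      (2 * ((l i - j.val : ℕ) : ℤ) - (∑ i, l i + 1 : ℕ)).natAbs := fun j => sp_psi l i j
  rw [Finset.sum_congr rfl (fun j _ => h2 j)]
  rw [legSum, ← Finset.sum_range_reflect,
    Fin.sum_univ_eq_sum_range (fun j => (2 * ((l i - j : ℕ) : ℤ) - (∑ i, l i + 1 : ℕ)).natAbs)]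
  refine Finset.sum_congr rfl fun j hj => ?_
  have := Finset.mem_range.1 hj
  have h3 : l i - 1 - j + 1 = l i - j := by omega
  rw [h3]

theorem sp_degree_none (l : Fin 4 → ℕ) (hl : ∀ i, 1 ≤ l i) : (Sp l).degree none = 4 := by
  have : (Sp l).neighborFinset none =
      (Finset.univ : Finset (Fin 4)).image (fun i => (some ⟨i, ⟨0, hl i⟩⟩ : SpV l)) := by
    ext x
    rcases x with _ | ⟨i, j⟩
    · simp
    · rw [SimpleGraph.mem_neighborFinset, sp_adj_none]
      simp only [Finset.mem_image, Finset.mem_univ, true_and]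
      constructor
      · intro h
        refine ⟨i, ?_⟩
        congr 2
        ext; simp [h]
      · rintro ⟨a, h⟩
        simp only [Option.some.injEq, Sigma.mk.injEq] at h
        obtain ⟨rfl, h⟩ := h
        have := eq_of_heq h
        subst this
        rfl
  rw [← SimpleGraph.card_neighborFinset_eq_degree, this, Finset.card_image_of_injective]
  · simp
  · intro a b h
    simp only [Option.some.injEq, Sigma.mk.injEq] at h
    exact h.1

theorem sp_degree_some (l : Fin 4 → ℕ) (i : Fin 4) (j : Fin (l i)) :
    (Sp l).degree (some ⟨i, j⟩) = 2 ↔ j.val + 1 < l i := by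
  have hpar : (Sp l).Adj (some ⟨i, j⟩) (spPar l (some ⟨i, j⟩)) := by
    rw [parG_adj]
    refine ⟨fun h => ?_, Or.inl rfl⟩
    have := spRank_par l (some ⟨i, j⟩) (by simp)
    rw [← h] at this
    omega
  by_cases hj : j.val + 1 < l i
  · have : (Sp l).neighborFinset (some ⟨i, j⟩) =
        {spPar l (some ⟨i, j⟩), some ⟨i, ⟨j.val + 1, hj⟩⟩} := by
      ext x
      rw [SimpleGraph.mem_neighborFinset, Finset.mem_insert, Finset.mem_singleton]
      constructor
      · intro h
        rw [parG_adj] at h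
        rcases h.2 with h | h
        · exact Or.inl h.symm
        · right
          rcases x with _ | ⟨i', j'⟩
          · simp [spPar] at h
          · have h' : (Sp l).Adj (some ⟨i, j⟩) (some ⟨i', j'⟩) := by
              rw [parG_adj]; assumption
            have h4 := spRank_par l (some ⟨i', j'⟩) (by simp)
            rw [h] at h4
            simp only [spRank] at h4
            obtain ⟨rfl, h5⟩ := (sp_adj_some l _ _ _ _).1 h'
            simp only [Option.some.injEq, Sigma.mk.injEq, heq_eq_eq, true_and]
            ext
            simp; omega
      · rintro (rfl | rfl)
        · exact hpar
        · rw [sp_adj_some]; simp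
    rw [← SimpleGraph.card_neighborFinset_eq_degree, this, Finset.card_pair]
    · simp [hj]
    · intro h
      have := spRank_par l (some ⟨i, j⟩) (by simp)
      rw [h] at this
      simp [spRank] at this
  · have : (Sp l).neighborFinset (some ⟨i, j⟩) = {spPar l (some ⟨i, j⟩)} := by
      ext x
      rw [SimpleGraph.mem_neighborFinset, Finset.mem_singleton]
      constructor
      · intro h
        rw [parG_adj] at h
        rcases h.2 with h | h
        · exact h.symm
        · exfalso
          rcases x with _ | ⟨i', j'⟩
          · simp [spPar] at h
          · have h' : (Sp l).Adj (some ⟨i, j⟩) (some ⟨i', j'⟩) := by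
              rw [parG_adj]; assumption
            have h4 := spRank_par l (some ⟨i', j'⟩) (by simp)
            rw [h] at h4
            simp only [spRank] at h4
            obtain ⟨rfl, h5⟩ := (sp_adj_some l _ _ _ _).1 h'
            omega
      · rintro rfl
        exact hpar
    rw [← SimpleGraph.card_neighborFinset_eq_degree, this]
    simp [hj]

theorem sp_degreeTwoCount (l : Fin 4 → ℕ) (hl : ∀ i, 1 ≤ l i) :
    degreeTwoCount (Sp l) = ∑ i, (l i - 1) := by
  have h : ∑ i, (l i - 1) = Fintype.card (Σ i : Fin 4, Fin (l i - 1)) := by simp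
  rw [h, ← Finset.card_univ]
  unfold degreeTwoCount
  symm
  refine Finset.card_bij (fun x _ => some ⟨x.1, ⟨x.2.val, by omega⟩⟩) ?_ ?_ ?_
  · rintro ⟨i, j⟩ _
    simp only [Finset.mem_filter, Finset.mem_univ, true_and]
    rw [sp_degree_some]
    simp; omega
  · rintro ⟨i, j⟩ _ ⟨i', j'⟩ _ h
    simp only [Option.some.injEq, Sigma.mk.injEq] at h
    obtain ⟨rfl, h⟩ := h
    have := eq_of_heq h
    simp only [Fin.mk.injEq] at this
    have : j = j' := by ext; exact this
    rw [this]
  · intro x hx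
    simp only [Finset.mem_filter, Finset.mem_univ, true_and] at hx
    rcases x with _ | ⟨i, j⟩
    · rw [sp_degree_none l hl] at hx
      omega
    · rw [sp_degree_some] at hx
      exact ⟨⟨i, ⟨j.val, by omega⟩⟩, Finset.mem_univ _, rfl⟩

def sp_perm (l : Fin 4 → ℕ) (σ : Equiv.Perm (Fin 4)) : Sp (l ∘ σ) ≃g Sp l where
  toEquiv := Equiv.optionCongr (Equiv.sigmaCongrLeft (β := fun i => Fin (l i)) σ)
  map_rel_iff' := by
    rintro (_ | ⟨i, j⟩) (_ | ⟨i', j'⟩)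
    · simp
    · change (Sp l).Adj none (some ⟨σ i', j'⟩) ↔ _
      rw [sp_adj_none, sp_adj_none]
    · change (Sp l).Adj (some ⟨σ i, j⟩) none ↔ _
      rw [SimpleGraph.adj_comm, sp_adj_none, SimpleGraph.adj_comm, sp_adj_none]
    · change (Sp l).Adj (some ⟨σ i, j⟩) (some ⟨σ i', j'⟩) ↔ _
      rw [sp_adj_some, sp_adj_some]
      simp

/-! ### Optimisation of leg lengths -/

theorem legSum_succ (n k : ℕ) :
    legSum n (k + 1) = legSum n k + (2 * ((k + 1 : ℕ) : ℤ) - n).natAbs := by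
  simp [legSum, Finset.sum_range_succ]

theorem legSum_merge_aux (n : ℕ) (b : ℕ) : ∀ a, b ≤ a → a + b + 4 ≤ n →
    legSum n (a + b + 1) + legSum n 1 ≤ legSum n (a + 1) + legSum n (b + 1) ∧
    (1 ≤ b → legSum n (a + b + 1) + legSum n 1 < legSum n (a + 1) + legSum n (b + 1)) := by
  induction b with
  | zero => intro a _ _; simp
  | succ b ih =>
    intro a hab hn
    have h1 := (ih (a + 1) (by omega) (by omega)).1
    have h2 := legSum_succ n (a + 1)
    have h3 := legSum_succ n (b + 1)
    have h4 : a + (b + 1) + 1 = a + 1 + b + 1 := by omega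
    rw [h4]
    omega

theorem legSum_merge (n a b : ℕ) (ha : 1 ≤ a) (hb : 1 ≤ b) (hn : a + b + 2 ≤ n) :
    legSum n (a + b - 1) + legSum n 1 ≤ legSum n a + legSum n b ∧
    (2 ≤ a → 2 ≤ b → legSum n (a + b - 1) + legSum n 1 < legSum n a + legSum n b) := by
  obtain ⟨a, rfl⟩ : ∃ k, a = k + 1 := ⟨a - 1, by omega⟩
  obtain ⟨b, rfl⟩ : ∃ k, b = k + 1 := ⟨b - 1, by omega⟩
  have h1 : a + 1 + (b + 1) - 1 = a + b + 1 := by omega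
  rw [h1]
  rcases le_total b a with h | h
  · have := legSum_merge_aux n b a h (by omega)
    exact ⟨this.1, fun _ _ => this.2 (by omega)⟩
  · have := legSum_merge_aux n a b h (by omega)
    rw [add_comm b a] at this
    have h2 := this.2
    constructor
    · omega
    · intro _ _
      have := h2 (by omega)
      omega

theorem legs_opt (n : ℕ) (a b c d : ℕ) (ha : 1 ≤ a) (hb : 1 ≤ b) (hc : 1 ≤ c) (hd : 1 ≤ d)
    (hn : a + b + c + d + 1 = n)
    (h : legSum n a + legSum n b + legSum n c + legSum n d ≤
      legSum n (n - 4) + legSum n 1 + legSum n 1 + legSum n 1) :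
    (b = 1 ∧ c = 1 ∧ d = 1) ∨ (a = 1 ∧ c = 1 ∧ d = 1) ∨ (a = 1 ∧ b = 1 ∧ d = 1) ∨
      (a = 1 ∧ b = 1 ∧ c = 1) := by
  have h1 := legSum_merge n a b ha hb (by omega)
  have h2 := legSum_merge n (a + b - 1) c (by omega) hc (by omega)
  have h3 := legSum_merge n (a + b - 1 + c - 1) d (by omega) hd (by omega)
  have h4 : a + b - 1 + c - 1 + d - 1 = n - 4 := by omega
  rw [h4] at h3
  obtain ⟨h1, h1'⟩ := h1
  obtain ⟨h2, h2'⟩ := h2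
  obtain ⟨h3, h3'⟩ := h3
  have k1 : ¬ (2 ≤ a ∧ 2 ≤ b) := fun hh => by have := h1' hh.1 hh.2; omega
  have k2 : ¬ (2 ≤ a + b - 1 ∧ 2 ≤ c) := fun hh => by have := h2' hh.1 hh.2; omega
  have k3 : ¬ (2 ≤ a + b - 1 + c - 1 ∧ 2 ≤ d) := fun hh => by have := h3' hh.1 hh.2; omega
  omega

/-! ### Trees with one branch vertex of degree four are spiders -/

theorem exists_branch {V : Type} [Fintype V] (G : SimpleGraph V) (hG : G.IsTree)
    (hcard : degreeTwoCount G + 5 = Fintype.card V) :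
    ∃ c, G.degree c = 4 ∧ ∀ v, v ≠ c → G.degree v ≤ 2 := by
  have hsum := G.sum_degrees_eq_twice_card_edges
  have hE := hG.card_edgeFinset
  have : Nontrivial V := Fintype.one_lt_card_iff_nontrivial.1 (by omega)
  have hpos : ∀ v, 0 < G.degree v := fun v => hG.connected.preconnected.degree_pos_of_nontrivial v
  set A := Finset.univ.filter fun v => G.degree v = 2 with hA
  set B := Finset.univ.filter fun v => ¬ G.degree v = 2 with hB
  have hAc : A.card + 5 = Fintype.card V := hcard
  have hAB : A.card + B.card = Fintype.card V := by
    rw [hA, hB, Finset.card_filter_add_card_filter_not, Finset.card_univ]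
  have hs : ∑ v ∈ A, G.degree v + ∑ v ∈ B, G.degree v = ∑ v, G.degree v :=
    Finset.sum_filter_add_sum_filter_not _ _ _
  have hsA : ∑ v ∈ A, G.degree v = A.card * 2 :=
    Finset.sum_const_nat fun v hv => (Finset.mem_filter.1 hv).2
  have hsB : ∑ v ∈ B, G.degree v = 8 := by omega
  have hex : ∃ c ∈ B, 3 ≤ G.degree c := by
    by_contra hcon
    push Not at hcon
    have : ∑ v ∈ B, G.degree v = B.card * 1 := Finset.sum_const_nat fun v hv => by
      have h1 := hcon v hv
      have h2 := hpos v
      have h3 := (Finset.mem_filter.1 hv).2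
      omega
    omega
  obtain ⟨c, hcB, hc⟩ := hex
  have hsc := Finset.add_sum_erase B (fun v => G.degree v) hcB
  have hcc := Finset.card_erase_of_mem hcB
  have hoth : ∀ v ∈ B.erase c, G.degree v = 1 := by
    intro v hv
    by_contra hv1
    have hvB := Finset.mem_of_mem_erase hv
    have h2 := hpos v
    have h3 := (Finset.mem_filter.1 hvB).2
    have hsv := Finset.add_sum_erase (B.erase c) (fun v => G.degree v) hv
    have hcv := Finset.card_erase_of_mem hv
    have : ((B.erase c).erase v).card • 1 ≤ ∑ v ∈ (B.erase c).erase v, G.degree v :=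
      Finset.card_nsmul_le_sum _ _ _ fun x _ => hpos x
    simp only [smul_eq_mul] at this hsc hsv
    omega
  have hse : ∑ v ∈ B.erase c, G.degree v = (B.erase c).card * 1 := Finset.sum_const_nat hoth
  refine ⟨c, by omega, fun v hv => ?_⟩
  by_cases h : G.degree v = 2
  · omega
  · have := hoth v (Finset.mem_erase.2 ⟨hv, Finset.mem_filter.2 ⟨Finset.mem_univ _, h⟩⟩)
    omega

theorem downclosed_eq_range (S : Finset ℕ) (h : ∀ k, k + 1 ∈ S → k ∈ S) :
    S = Finset.range S.card := by
  have h1 : ∀ m, m ∈ S → Finset.range (m + 1) ⊆ S := by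
    intro m
    induction m with
    | zero => intro hm; simpa using hm
    | succ m ih =>
      intro hm
      rw [Finset.range_add_one]
      exact Finset.insert_subset hm (ih (h m hm))
  refine Finset.eq_of_subset_of_card_le ?_ (by simp)
  intro m hm
  have := Finset.card_le_card (h1 m hm)
  rw [Finset.card_range] at this
  exact Finset.mem_range.2 this

theorem exists_spider {V : Type} [Fintype V] (G : SimpleGraph V) (hG : G.IsTree) (c : V)
    (hc : G.degree c = 4) (hdeg : ∀ v, v ≠ c → G.degree v ≤ 2) :
    ∃ l : Fin 4 → ℕ, (∀ i, 1 ≤ l i) ∧ Nonempty (G ≃g Sp l) := by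
  obtain ⟨q, hqc, hqd, hGq⟩ := tree_parG G hG c
  -- distance to the root
  set d : V → ℕ := fun v => G.dist c v with hd
  have hadj : ∀ u v, G.Adj u v ↔ u ≠ v ∧ (q u = v ∨ q v = u) := fun u v => by
    conv_lhs => rw [hGq]
    exact parG_adj q u v
  have hqd' : ∀ v, v ≠ c → d (q v) + 1 = d v := hqd
  have hd0 : ∀ v, d v = 0 ↔ v = c := fun v => by
    rw [hd]; simp only
    rw [hG.connected.dist_eq_zero_iff]; exact eq_comm
  have hqne : ∀ v, v ≠ c → v ≠ q v := fun v hv h => by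
    have := hqd' v hv
    rw [← h] at this; omega
  -- injectivity of the parent function below the root
  have hinj : ∀ u v, u ≠ c → v ≠ c → q u = q v → q u ≠ c → u = v := by
    intro u v hu hv huv hne
    by_contra huv'
    have h1 := hdeg (q u) hne
    have h2 : ({u, v, q (q u)} : Finset V) ⊆ G.neighborFinset (q u) := by
      intro x hx
      rw [SimpleGraph.mem_neighborFinset, hadj]
      simp only [Finset.mem_insert, Finset.mem_singleton] at hx
      rcases hx with rfl | rfl | rfl
      · exact ⟨(hqne _ hu).symm, Or.inr rfl⟩
      · rw [huv]; exact ⟨(hqne _ hv).symm, Or.inr rfl⟩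
      · exact ⟨hqne _ hne, Or.inl rfl⟩
    have h3 := Finset.card_le_card h2
    rw [SimpleGraph.card_neighborFinset_eq_degree] at h3
    have e1 := hqd' u hu
    have e2 := hqd' v hv
    have e3 := hqd' (q u) hne
    rw [← huv] at e2
    have : ({u, v, q (q u)} : Finset V).card = 3 := by
      rw [Finset.card_eq_three]
      refine ⟨u, v, q (q u), huv', ?_, ?_, rfl⟩
      · intro h; rw [← h] at e3; omega
      · intro h; rw [← h] at e3; omega
    omega
  -- top vertex of the leg
  obtain ⟨e⟩ : Nonempty ({x // x ∈ G.neighborFinset c} ≃ Fin 4) := by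
    have : Fintype.card {x // x ∈ G.neighborFinset c} = 4 := by
      rw [Fintype.card_coe, SimpleGraph.card_neighborFinset_eq_degree, hc]
    exact ⟨Fintype.equivFinOfCardEq this⟩
  have hnb : ∀ v, v ∈ G.neighborFinset c ↔ v ≠ c ∧ q v = c := by
    intro v
    rw [SimpleGraph.mem_neighborFinset, hadj]
    constructor
    · rintro ⟨h, h' | h'⟩
      · exact absurd (hqc.symm.trans h') h
      · exact ⟨h.symm, h'⟩
    · rintro ⟨h, h'⟩
      exact ⟨h.symm, Or.inr h'⟩
  have hleg : ∃ leg : V → Fin 4, (∀ x : {x // x ∈ G.neighborFinset c}, leg x = e x) ∧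
      ∀ v, v ≠ c → q v ≠ c → leg v = leg (q v) := by
    have htop : ∀ k v, d v = k + 1 → q^[k] v ∈ G.neighborFinset c := by
      intro k
      induction k with
      | zero =>
        intro v hv
        have hvc : v ≠ c := fun h => by rw [(hd0 v).2 h] at hv; omega
        have := hqd' v hvc
        exact (hnb v).2 ⟨hvc, (hd0 _).1 (by omega)⟩
      | succ k ih =>
        intro v hv
        have hvc : v ≠ c := fun h => by rw [(hd0 v).2 h] at hv; omega
        have := hqd' v hvc
        rw [Function.iterate_succ_apply]
        exact ih (q v) (by omega)
    refine ⟨fun v => if h : q^[d v - 1] v ∈ G.neighborFinset c then e ⟨_, h⟩ else 0, ?_, ?_⟩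
    · rintro ⟨x, hx⟩
      have hx' := (hnb x).1 hx
      have h1 := hqd' x hx'.1
      rw [hx'.2, (hd0 c).2 rfl] at h1
      have h2 : q^[d x - 1] x = x := by rw [← h1]; rfl
      simp only [h2]
      rw [dif_pos hx]
    · intro v hv hqv
      have h1 := hqd' v hv
      have h2 : d (q v) ≠ 0 := fun h => hqv ((hd0 _).1 h)
      have h3 : q^[d v - 1] v = q^[d (q v) - 1] (q v) := by
        have : d v - 1 = (d (q v) - 1) + 1 := by omega
        rw [this, Function.iterate_succ_apply]
      simp only [h3]
  obtain ⟨leg, hleg1, hleg2⟩ := hleg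
  -- coordinates are injective
  have hcoord : ∀ k u v, d u = k + 1 → d v = k + 1 → leg u = leg v → u = v := by
    intro k
    induction k with
    | zero =>
      intro u v hu hv h
      have huc : u ≠ c := fun h => by rw [(hd0 u).2 h] at hu; omega
      have hvc : v ≠ c := fun h => by rw [(hd0 v).2 h] at hv; omega
      have h1 := hqd' u huc
      have h2 := hqd' v hvc
      have hu' := (hnb u).2 ⟨huc, (hd0 _).1 (by omega)⟩
      have hv' := (hnb v).2 ⟨hvc, (hd0 _).1 (by omega)⟩
      have h3 := hleg1 ⟨u, hu'⟩
      have h4 := hleg1 ⟨v, hv'⟩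
      simp only at h3 h4
      rw [h3, h4] at h
      simpa using e.injective h
    | succ k ih =>
      intro u v hu hv h
      have huc : u ≠ c := fun h => by rw [(hd0 u).2 h] at hu; omega
      have hvc : v ≠ c := fun h => by rw [(hd0 v).2 h] at hv; omega
      have h1 := hqd' u huc
      have h2 := hqd' v hvc
      have hqu : q u ≠ c := fun h => by rw [(hd0 _).2 h] at h1; omega
      have hqv : q v ≠ c := fun h => by rw [(hd0 _).2 h] at h2; omega
      refine hinj u v huc hvc (ih _ _ (by omega) (by omega) ?_) hqu
      rw [← hleg2 u huc hqu, ← hleg2 v hvc hqv, h]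
  -- levels in each leg
  let S : Fin 4 → Finset ℕ := fun i =>
    (Finset.univ.filter fun v => v ≠ c ∧ leg v = i).image fun v => d v - 1
  have hSmem : ∀ i k, k ∈ S i ↔ ∃ v, v ≠ c ∧ leg v = i ∧ d v = k + 1 := by
    intro i k
    simp only [S, Finset.mem_image, Finset.mem_filter, Finset.mem_univ, true_and]
    constructor
    · rintro ⟨v, ⟨h1, h2⟩, h3⟩
      have : d v ≠ 0 := fun h => h1 ((hd0 v).1 h)
      exact ⟨v, h1, h2, by omega⟩
    · rintro ⟨v, h1, h2, h3⟩
      exact ⟨v, ⟨h1, h2⟩, by omega⟩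
  have hSr : ∀ i, S i = Finset.range (S i).card := by
    intro i
    apply downclosed_eq_range
    intro k hk
    obtain ⟨v, h1, h2, h3⟩ := (hSmem _ _).1 hk
    have h4 := hqd' v h1
    have h5 : q v ≠ c := fun h => by rw [(hd0 _).2 h] at h4; omega
    exact (hSmem _ _).2 ⟨q v, h5, by rw [← hleg2 v h1 h5, h2], by omega⟩
  have hlt : ∀ i k, k < (S i).card ↔ ∃ v, v ≠ c ∧ leg v = i ∧ d v = k + 1 := by
    intro i k
    rw [← hSmem i k, ← Finset.mem_range, ← hSr i]
  let l : Fin 4 → ℕ := fun i => (S i).card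
  have hl1 : ∀ i, 1 ≤ l i := by
    intro i
    refine (hlt i 0).2 ?_
    obtain ⟨x, hx⟩ := e.surjective i
    have hx' := (hnb x).1 x.2
    have h1 := hqd' x hx'.1
    rw [hx'.2, (hd0 c).2 rfl] at h1
    exact ⟨x, hx'.1, by rw [hleg1, hx], h1.symm⟩
  have hbd : ∀ v, v ≠ c → d v - 1 < l (leg v) := by
    intro v hv
    have : d v ≠ 0 := fun h => hv ((hd0 v).1 h)
    exact (hlt _ _).2 ⟨v, hv, rfl, by omega⟩
  let φ : V → SpV l := fun v => if h : v = c then none else some ⟨leg v, ⟨d v - 1, hbd v h⟩⟩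
  have hφc : φ c = none := by simp [φ]
  have hφ : ∀ v (h : v ≠ c), φ v = some ⟨leg v, ⟨d v - 1, hbd v h⟩⟩ := fun v h => by simp [φ, h]
  have hext : ∀ (i i' : Fin 4) (k k' : ℕ) (h : k < l i) (h' : k' < l i'), i = i' → k = k' →
      (some ⟨i, ⟨k, h⟩⟩ : SpV l) = some ⟨i', ⟨k', h'⟩⟩ := by
    intro i i' k k' h h' hi hk
    subst hi
    subst hk
    rfl
  have hext' : ∀ (i i' : Fin 4) (k k' : ℕ) (h : k < l i) (h' : k' < l i'),
      (some ⟨i, ⟨k, h⟩⟩ : SpV l) = some ⟨i', ⟨k', h'⟩⟩ → i = i' ∧ k = k' := by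
    intro i i' k k' h h' heq
    simp only [Option.some.injEq, Sigma.mk.injEq] at heq
    obtain ⟨rfl, heq⟩ := heq
    have := eq_of_heq heq
    simp only [Fin.mk.injEq] at this
    exact ⟨rfl, this⟩
  have hφinj : Function.Injective φ := by
    intro u v h
    by_cases hu : u = c
    · by_cases hv : v = c
      · rw [hu, hv]
      · rw [hu, hφc, hφ v hv] at h; simp at h
    · by_cases hv : v = c
      · rw [hv, hφc, hφ u hu] at h; simp at h
      · rw [hφ u hu, hφ v hv] at h
        obtain ⟨h1, h2⟩ := hext' _ _ _ _ _ _ h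
        have hu0 : d u ≠ 0 := fun h => hu ((hd0 u).1 h)
        have hv0 : d v ≠ 0 := fun h => hv ((hd0 v).1 h)
        exact hcoord (d u - 1) u v (by omega) (by omega) h1
  have hφsurj : Function.Surjective φ := by
    rintro (_ | ⟨i, k, hk⟩)
    · exact ⟨c, hφc⟩
    · obtain ⟨v, h1, h2, h3⟩ := (hlt i k).1 hk
      refine ⟨v, ?_⟩
      rw [hφ v h1]
      exact hext _ _ _ _ _ _ h2 (by omega)
  have hφq : ∀ v, φ (q v) = spPar l (φ v) := by
    intro v
    by_cases hv : v = c
    · rw [hv, hqc, hφc]; rfl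
    · rw [hφ v hv]
      have h1 := hqd' v hv
      by_cases hqv : q v = c
      · rw [hqv, hφc]
        rw [hqv, (hd0 c).2 rfl] at h1
        have : d v - 1 = 0 := by omega
        simp [spPar, this]
      · have h0 : d (q v) ≠ 0 := fun h => hqv ((hd0 _).1 h)
        rw [hφ _ hqv]
        have : d v - 1 ≠ 0 := by omega
        simp only [spPar, if_neg this]
        exact hext _ _ _ _ _ _ (hleg2 v hv hqv).symm (by omega)
  refine ⟨l, hl1, ⟨⟨Equiv.ofBijective φ ⟨hφinj, hφsurj⟩, ?_⟩⟩⟩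
  intro u v
  change (Sp l).Adj (φ u) (φ v) ↔ G.Adj u v
  rw [hadj, parG_adj, ← hφq, ← hφq, hφinj.ne_iff, hφinj.eq_iff, hφinj.eq_iff]

/-! ### The extremal tree -/

def lF (n : ℕ) : Fin 4 → ℕ := ![n - 4, 1, 1, 1]

theorem catF_adj (n : ℕ) (u v : Fin n) (hn : 5 ≤ n) : (catF n 0 0).Adj u v ↔ u ≠ v ∧
    ((if u.val < n - 2 then u.val - 1 else 1) = v.val ∨
     (if v.val < n - 2 then v.val - 1 else 1) = u.val) := by
  have key : ∀ u : Fin n, (if u.val < n - 0 - 0 - 2 then u.val - 1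
    else if u.val = n - 0 - 0 - 2 then 1
    else if u.val < n - 0 then u.val - (n - 0 - 0 - 2)
    else u.val - 0 - 0 - 3) = (if u.val < n - 2 then u.val - 1 else 1) := by
    intro u
    have := u.2
    simp only [Nat.sub_zero]
    split_ifs <;> omega
  unfold catF parentGraph
  rw [SimpleGraph.fromRel_adj]
  simp only [key]

theorem catF_iso (n : ℕ) (hn : 5 ≤ n) : Nonempty (Sp (lF n) ≃g catF n 0 0) := by
  have hlt : ∀ j : Fin (lF n 0), j.val < n - 4 := fun j => j.2
  let ψ : SpV (lF n) → Fin n := fun x => match x with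
    | none => ⟨1, by omega⟩
    | some ⟨0, j⟩ => ⟨j.val + 2, by have := hlt j; omega⟩
    | some ⟨1, _⟩ => ⟨0, by omega⟩
    | some ⟨2, _⟩ => ⟨n - 2, by omega⟩
    | some ⟨3, _⟩ => ⟨n - 1, by omega⟩
  have h1 : ∀ j : Fin (lF n 1), j.val = 0 := fun j => by
    have : j.val < 1 := j.2
    omega
  have h2 : ∀ j : Fin (lF n 2), j.val = 0 := fun j => by
    have : j.val < 1 := j.2
    omega
  have h3 : ∀ j : Fin (lF n 3), j.val = 0 := fun j => by
    have : j.val < 1 := j.2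
    omega
  have hinj : Function.Injective ψ := by
    rintro (_ | ⟨i, j⟩) (_ | ⟨i', j'⟩) h
    · rfl
    · exfalso
      have h := congrArg Fin.val h
      fin_cases i' <;> simp [ψ] at h <;> omega
    · exfalso
      have h := congrArg Fin.val h
      fin_cases i <;> simp [ψ] at h <;> omega
    · have h := congrArg Fin.val h
      have hii : i = i' ∧ j.val = j'.val := by
        fin_cases i <;> fin_cases i' <;> simp [ψ] at h ⊢ <;>
          first
          | exact h
          | (rw [h1 j, h1 j'])
          | (rw [h2 j, h2 j'])
          | (rw [h3 j, h3 j'])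
          | (have := hlt j; omega)
          | (have := hlt j'; omega)
          | omega
      obtain ⟨rfl, hj⟩ := hii
      have : j = j' := by ext; exact hj
      rw [this]
  have hcard : Fintype.card (SpV (lF n)) = Fintype.card (Fin n) := by
    rw [sp_card, Fin.sum_univ_four, Fintype.card_fin]
    simp only [lF]
    simp
    omega
  have hbij : Function.Bijective ψ := (Fintype.bijective_iff_injective_and_card ψ).2 ⟨hinj, hcard⟩
  refine ⟨⟨Equiv.ofBijective ψ hbij, ?_⟩⟩
  intro x y
  change (catF n 0 0).Adj (ψ x) (ψ y) ↔ _
  have hval : ∀ i (j : Fin (lF n i)),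
      (i.val = 0 ∧ (ψ (some ⟨i, j⟩)).val = j.val + 2 ∧ j.val < n - 4) ∨
      (i.val = 1 ∧ (ψ (some ⟨i, j⟩)).val = 0 ∧ j.val = 0) ∨
      (i.val = 2 ∧ (ψ (some ⟨i, j⟩)).val = n - 2 ∧ j.val = 0) ∨
      (i.val = 3 ∧ (ψ (some ⟨i, j⟩)).val = n - 1 ∧ j.val = 0) := by
    intro i j
    fin_cases i
    · exact Or.inl ⟨rfl, rfl, hlt j⟩
    · exact Or.inr (Or.inl ⟨rfl, rfl, h1 j⟩)
    · exact Or.inr (Or.inr (Or.inl ⟨rfl, rfl, h2 j⟩))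
    · exact Or.inr (Or.inr (Or.inr ⟨rfl, rfl, h3 j⟩))
  have hnone : (ψ none).val = 1 := rfl
  have hno : ∀ i (j : Fin (lF n i)), (catF n 0 0).Adj (ψ none) (ψ (some ⟨i, j⟩)) ↔
      (Sp (lF n)).Adj none (some ⟨i, j⟩) := by
    intro i j
    rw [sp_adj_none, catF_adj n _ _ hn, ← Fin.val_ne_iff, hnone]
    have := hval i j
    split_ifs <;> omega
  rcases x with _ | ⟨i, j⟩ <;> rcases y with _ | ⟨i', j'⟩
  · simp
  · exact hno i' j'
  · rw [SimpleGraph.adj_comm, hno, SimpleGraph.adj_comm]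
  · rw [sp_adj_some, catF_adj n _ _ hn, ← Fin.val_ne_iff, Fin.ext_iff]
    have := hval i j
    have := hval i' j'
    split_ifs <;> omega

theorem spider_lF (n : ℕ) (l : Fin 4 → ℕ) (i : Fin 4) (hn : ∑ i, l i + 1 = n)
    (hl : ∀ j, j ≠ i → l j = 1) : Nonempty (Sp l ≃g Sp (lF n)) := by
  have : l = lF n ∘ Equiv.swap 0 i := by
    rw [Fin.sum_univ_four] at hn
    fin_cases i <;> simp [Fin.forall_fin_succ] at hl <;> funext k <;> fin_cases k <;>
      simp [lF, hl, Equiv.swap_apply_def] <;> omega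
  rw [this]
  exact ⟨sp_perm _ _⟩

/-- if n - t = 5, the tree minimizing the Mostar index among trees of order n
with exactly t vertices of degree two (0 ≤ t ≤ n-4) is F_{n,0,0}. -/
theorem min_mostar_degree_two_five (n t : ℕ) (ht : t ≤ n - 4) (hn : 4 ≤ n)
    (hnt : n - t = 5)
    (T : SimpleGraph (Fin n)) (hT : T.IsTree) (h2 : degreeTwoCount T = t)
    (hmin : ∀ T' : SimpleGraph (Fin n), T'.IsTree → degreeTwoCount T' = t →
      mostar T ≤ mostar T') :
    Nonempty (T ≃g catF n 0 0) := by
  have hn5 : 5 ≤ n := by omega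
  obtain ⟨c, hc, hdeg⟩ := exists_branch T hT (by rw [h2, Fintype.card_fin]; omega)
  obtain ⟨l, hl, ⟨f⟩⟩ := exists_spider T hT c hc hdeg
  obtain ⟨g⟩ := catF_iso n hn5
  have hsum : ∑ i, l i + 1 = n := by
    rw [← sp_card l, ← Fintype.card_congr f.toEquiv, Fintype.card_fin]
  have hlF : ∀ i, 1 ≤ lF n i := by
    intro i
    fin_cases i <;> simp [lF]
    omega
  have hFsum : ∑ i, lF n i + 1 = n := by
    rw [← sp_card (lF n), Fintype.card_congr g.toEquiv, Fintype.card_fin]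
  have hle := hmin (catF n 0 0) (g.isTree_iff.1 (sp_isTree _)) (by
    rw [← iso_degreeTwoCount g, sp_degreeTwoCount _ hlF, Fin.sum_univ_four]
    simp [lF]
    omega)
  rw [iso_mostar f hT.connected, ← iso_mostar g (sp_isTree _).connected, sp_mostar, sp_mostar,
    hsum, hFsum, Fin.sum_univ_four, Fin.sum_univ_four] at hle
  have hopt := legs_opt n (l 0) (l 1) (l 2) (l 3) (hl _) (hl _) (hl _) (hl _)
    (by rw [← hsum, Fin.sum_univ_four]) hle
  have hi : ∃ i, ∀ j, j ≠ i → l j = 1 := by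
    rcases hopt with h | h | h | h
    · exact ⟨0, fun j hj => by fin_cases j <;> simp_all⟩
    · exact ⟨1, fun j hj => by fin_cases j <;> simp_all⟩
    · exact ⟨2, fun j hj => by fin_cases j <;> simp_all⟩
    · exact ⟨3, fun j hj => by fin_cases j <;> simp_all⟩
  obtain ⟨i, hi⟩ := hi
  obtain ⟨k⟩ := spider_lF n l i hsum hi
  exact ⟨(f.trans k).trans g⟩
end

section
/- Let n and t be integers with 0 ≤ t ≤ n−4 such that n−t is odd and n−t ≥ 7, and let T be a tree of order n with exactly t vertices of degree two that has the minimum Mostar index among all such trees. Then T is isomorphic to F_{n,⌈(n−t−5)/4⌉−1,⌊(n−t−5)/4⌋+1}. -/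
open Finset SimpleGraph

open scoped Classical

set_option linter.unusedSectionVars false

section Basics
variable {V : Type*} [Fintype V]

/-- adjacent vertices have distance to a given vertex differing by exactly one -/
lemma tree_adj_dist {G : SimpleGraph V} (hG : G.IsTree) {u v : V} (h : G.Adj u v) (w : V) :
    G.dist w u = G.dist w v + 1 ∨ G.dist w v = G.dist w u + 1 := by
  have := hG.dist_eq_dist_add_one_of_adj w h
  omega

/-- a vertex has at most one neighbour closer to the root -/
lemma tree_parent_unique {G : SimpleGraph V} (hG : G.IsTree) {x a b r : V}
    (ha : G.Adj x a) (hb : G.Adj x b) (h1 : G.dist a r + 1 = G.dist x r)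
    (h2 : G.dist b r + 1 = G.dist x r) : a = b := by
  obtain ⟨pa, hpa⟩ := hG.1.exists_walk_length_eq_dist a r
  obtain ⟨pb, hpb⟩ := hG.1.exists_walk_length_eq_dist b r
  have hqa : (Walk.cons ha pa).IsPath := by
    apply Walk.isPath_of_length_eq_dist
    simp [hpa, h1]
  have hqb : (Walk.cons hb pb).IsPath := by
    apply Walk.isPath_of_length_eq_dist
    simp [hpb, h2]
  have hs := hG.2.subsingleton_path x r
  have h3 : Walk.cons ha pa = Walk.cons hb pb :=
    congrArg Subtype.val (hs.elim (⟨_, hqa⟩ : G.Path x r) ⟨_, hqb⟩)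
  have h4 := congrArg Walk.snd h3
  simpa using h4

/-- existence of a neighbour closer to the root -/
lemma exists_parent {G : SimpleGraph V} (hG : G.Connected) {x r : V} (h : 0 < G.dist x r) :
    ∃ y, G.Adj x y ∧ G.dist y r + 1 = G.dist x r := by
  obtain ⟨p, hp⟩ := hG.exists_walk_length_eq_dist x r
  cases p with
  | nil => simp at h
  | cons ha q =>
    rename_i y
    refine ⟨y, ha, ?_⟩
    have h1 := G.dist_le q
    have h2 := hG.dist_triangle (u := x) (v := y) (w := r)
    have h3 : G.dist x y = 1 := dist_eq_one_iff_adj.2 ha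
    simp at hp
    omega

/-- an edge joining different sides of the edge `uv` is `uv` itself -/
lemma tree_cross {G : SimpleGraph V} (hG : G.IsTree) {x y u v : V} (hxy : G.Adj x y)
    (huv : G.Adj u v) (h1 : G.dist x u < G.dist x v) (h2 : G.dist y v < G.dist y u) :
    x = u ∧ y = v := by
  have e1 := tree_adj_dist hG huv x
  have e2 := tree_adj_dist hG huv y
  have e3 := tree_adj_dist hG hxy u
  have e4 := tree_adj_dist hG hxy v
  have c1 := G.dist_comm (u := u) (v := x)
  have c2 := G.dist_comm (u := u) (v := y)
  have c3 := G.dist_comm (u := v) (v := x)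
  have c4 := G.dist_comm (u := v) (v := y)
  have hab : G.dist x u = G.dist y v := by omega
  by_cases h0 : G.dist x u = 0
  · exact ⟨hG.1.dist_eq_zero_iff.1 h0, hG.1.dist_eq_zero_iff.1 (hab ▸ h0)⟩
  · exfalso
    obtain ⟨z, hz, hz2⟩ := exists_parent hG.1 (x := x) (r := u) (by omega)
    have e5 := tree_adj_dist hG huv z
    have e6 := tree_adj_dist hG hz v
    have c5 := G.dist_comm (u := v) (v := z)
    have : z = y := by
      apply tree_parent_unique hG hz hxy (r := v) <;> omega
    subst this
    omega

/-- edges separating `c` and `w` -/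
noncomputable def sepEdges (G : SimpleGraph V) (c w : V) : Finset (Sym2 V) :=
  Finset.univ.filter fun e => ∃ u v, e = s(u, v) ∧ G.Adj u v ∧ G.dist c u < G.dist c v ∧
    G.dist w v < G.dist w u

lemma sepEdges_card_le {G : SimpleGraph V} (hG : G.IsTree) {c w : V} (p : G.Walk w c) :
    (sepEdges G c w).card ≤ p.length := by
  induction p with
  | nil =>
    simp only [Walk.length_nil, Nat.le_zero, Finset.card_eq_zero]
    ext e
    simp only [sepEdges, Finset.mem_filter, Finset.mem_univ, true_and, Finset.notMem_empty,
      iff_false]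
    rintro ⟨u, v, _, _, h1, h2⟩
    omega
  | cons h q ih =>
    rename_i a b c
    have hsub : sepEdges G c a ⊆ insert s(a, b) (sepEdges G c b) := by
      intro e he
      simp only [sepEdges, Finset.mem_filter, Finset.mem_univ, true_and, Finset.mem_insert] at he ⊢
      obtain ⟨u, v, rfl, huv, h1, h2⟩ := he
      by_cases hb : G.dist b v < G.dist b u
      · exact Or.inr ⟨u, v, rfl, huv, h1, hb⟩
      · left
        have := tree_adj_dist hG huv b
        have := tree_cross hG h huv.symm h2 (by omega)
        rw [this.1, this.2, Sym2.eq_swap]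
    calc _ ≤ _ := Finset.card_le_card hsub
      _ ≤ _ := Finset.card_insert_le _ _
      _ ≤ _ := by simpa using ih

lemma mostarPsi_mk (G : SimpleGraph V) (u v : V) : mostarPsi G s(u, v) =
    (((Finset.univ.filter fun w => G.dist w u < G.dist w v).card : ℤ) -
      ((Finset.univ.filter fun w => G.dist w v < G.dist w u).card : ℤ)).natAbs := rfl

lemma sides_card {G : SimpleGraph V} (hG : G.IsTree) {u v : V} (h : G.Adj u v) :
    (Finset.univ.filter fun w => G.dist w u < G.dist w v).card +
      (Finset.univ.filter fun w => G.dist w v < G.dist w u).card = Fintype.card V := by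
  rw [← Finset.card_univ, ← Finset.card_filter_add_card_filter_not
    (s := Finset.univ) (fun w => G.dist w u < G.dist w v)]
  congr 2
  ext w
  have := tree_adj_dist hG h w
  simp only [Finset.mem_filter, Finset.mem_univ, true_and]
  omega

lemma mostarPsi_ge {G : SimpleGraph V} (hG : G.IsTree) (c : V) {e : Sym2 V}
    (he : e ∈ G.edgeFinset) :
    (Fintype.card V : ℤ) ≤ (mostarPsi G e : ℤ) +
      2 * ((Finset.univ.filter fun w => e ∈ sepEdges G c w).card : ℤ) := by
  induction e using Sym2.ind with
  | _ u v =>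
    have huv : G.Adj u v := by simpa using he
    wlog h : G.dist c u < G.dist c v generalizing u v
    · rw [Sym2.eq_swap]
      have hd := tree_adj_dist hG huv c
      exact this v u (by rw [Sym2.eq_swap]; exact he) huv.symm (by omega)
    have h1 := sides_card hG huv
    have h2 : (Finset.univ.filter fun w => G.dist w v < G.dist w u).card ≤
        (Finset.univ.filter fun w => s(u, v) ∈ sepEdges G c w).card := by
      apply Finset.card_le_card
      intro w hw
      simp only [sepEdges, Finset.mem_filter, Finset.mem_univ, true_and] at hw ⊢
      exact ⟨u, v, rfl, huv, h, hw⟩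
    rw [mostarPsi_mk]
    omega

/-- sum of distances -/
noncomputable def distSum (G : SimpleGraph V) (c : V) : ℕ := ∑ w, G.dist w c

lemma mostar_ge {G : SimpleGraph V} (hG : G.IsTree) (c : V) :
    (Fintype.card V : ℤ) * (Fintype.card V - 1) ≤ mostar G + 2 * distSum G c := by
  have h1 : ∑ e ∈ G.edgeFinset, (Fintype.card V : ℤ) ≤ ∑ e ∈ G.edgeFinset,
      ((mostarPsi G e : ℤ) + 2 * ((Finset.univ.filter fun w => e ∈ sepEdges G c w).card : ℤ)) :=
    Finset.sum_le_sum fun e he => mostarPsi_ge hG c he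
  have h2 := hG.card_edgeFinset
  have h3 : ∑ e ∈ G.edgeFinset, (Finset.univ.filter fun w => e ∈ sepEdges G c w).card ≤
      distSum G c := by
    have : ∀ e, (Finset.univ.filter fun w => e ∈ sepEdges G c w).card =
      ∑ w, if e ∈ sepEdges G c w then 1 else 0 := fun e => by simp
    simp_rw [this]
    rw [Finset.sum_comm]
    apply Finset.sum_le_sum
    intro w _
    obtain ⟨p, hp⟩ := hG.1.exists_walk_length_eq_dist w c
    rw [← hp]
    refine le_trans ?_ (sepEdges_card_le hG p)
    rw [← Finset.sum_filter, Finset.sum_const, smul_eq_mul, mul_one]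
    apply Finset.card_le_card
    intro e he
    exact (Finset.mem_filter.1 he).2
  rw [Finset.sum_const, Finset.sum_add_distrib, ← Finset.mul_sum, nsmul_eq_mul] at h1
  unfold mostar
  push_cast
  have h3' : ∑ e ∈ G.edgeFinset, ((Finset.univ.filter fun w => e ∈ sepEdges G c w).card : ℤ) ≤
      distSum G c := by exact_mod_cast h3
  have h4 : (G.edgeFinset.card : ℤ) = Fintype.card V - 1 := by omega
  rw [h4] at h1
  nlinarith

/-- the distances to the vertices of a path in a tree -/
lemma tree_proj {G : SimpleGraph V} (hG : G.IsTree) (p : ℕ → V) (d : ℕ)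
    (hadj : ∀ i < d, G.Adj (p i) (p (i + 1))) (hne : ∀ i, i + 2 ≤ d → p i ≠ p (i + 2)) (v : V) :
    ∃ i h : ℕ, i ≤ d ∧ ∀ j ≤ d, (G.dist v (p j) : ℤ) = h + |(j : ℤ) - i| := by
  induction d with
  | zero =>
    refine ⟨0, G.dist v (p 0), le_rfl, ?_⟩
    intro j hj
    obtain rfl : j = 0 := by omega
    simp
  | succ d ih =>
    obtain ⟨i, h, hi, hj⟩ := ih (fun i hi => hadj i (by omega)) (fun i hi => hne i (by omega))
    have e1 := tree_adj_dist hG (hadj d (by omega)) v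
    have e2 := hj d le_rfl
    by_cases hid : i < d
    · refine ⟨i, h, by omega, ?_⟩
      intro j hjd
      by_cases hj' : j ≤ d
      · exact hj j hj'
      obtain rfl : j = d + 1 := by omega
      have e3 := hj (d - 1) (by omega)
      rcases e1 with e1 | e1
      · exfalso
        apply hne (d - 1) (by omega)
        have e4 : G.Adj (p d) (p (d - 1)) := by
          have := (hadj (d - 1) (by omega)).symm
          rwa [Nat.sub_add_cancel (by omega)] at this
        have e5 : d - 1 + 2 = d + 1 := by omega
        rw [e5]
        have c1 := G.dist_comm (u := v) (v := p d)
        have c2 := G.dist_comm (u := v) (v := p (d + 1))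
        have c3 := G.dist_comm (u := v) (v := p (d - 1))
        apply tree_parent_unique hG e4 (hadj d (by omega)) (r := v)
        · rw [abs_of_nonneg (by omega)] at e2 e3
          omega
        · omega
      · rw [abs_of_nonneg (by omega)] at e2 ⊢
        push_cast
        omega
    · obtain rfl : i = d := by omega
      simp only [sub_self, abs_zero, add_zero] at e2
      rcases e1 with e1 | e1
      · refine ⟨i + 1, h - 1, le_rfl, ?_⟩
        intro j hjd
        by_cases hj' : j ≤ i
        · rw [hj j hj', abs_of_nonpos (by omega), abs_of_nonpos (by push_cast; omega)]
          push_cast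
          omega
        · obtain rfl : j = i + 1 := by omega
          simp
          omega
      · refine ⟨i, h, by omega, ?_⟩
        intro j hjd
        by_cases hj' : j ≤ i
        · exact hj j hj'
        · obtain rfl : j = i + 1 := by omega
          push_cast
          rw [abs_of_nonneg (by omega)]
          omega

end Basics

section SpinePart
variable {V : Type*} [Fintype V]

/-- a path of length `d` in a graph, with the projection onto the path -/
structure Spine (G : SimpleGraph V) (d : ℕ) (p : ℕ → V) (pr ht : V → ℕ) : Prop where
  adj : ∀ i < d, G.Adj (p i) (p (i + 1))
  prle : ∀ v, pr v ≤ d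
  proj : ∀ v, ∀ j ≤ d, (G.dist v (p j) : ℤ) = ht v + |(j : ℤ) - pr v|

lemma exists_spine {G : SimpleGraph V} (hG : G.IsTree) (p : ℕ → V) (d : ℕ)
    (hadj : ∀ i < d, G.Adj (p i) (p (i + 1))) (hne : ∀ i, i + 2 ≤ d → p i ≠ p (i + 2)) :
    ∃ pr ht, Spine G d p pr ht := by
  choose pr ht h1 h2 using tree_proj hG p d hadj hne
  exact ⟨pr, ht, hadj, h1, h2⟩

variable {G : SimpleGraph V} {d : ℕ} {p : ℕ → V} {pr ht : V → ℕ}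

lemma Spine.pr_p (S : Spine G d p pr ht) {i : ℕ} (hi : i ≤ d) : pr (p i) = i ∧ ht (p i) = 0 := by
  have h := S.proj (p i) i hi
  simp only [dist_self, Nat.cast_zero] at h
  have h1 := abs_nonneg ((i : ℤ) - pr (p i))
  have h2 : |(i : ℤ) - pr (p i)| = 0 := by omega
  rw [abs_eq_zero] at h2
  omega

lemma Spine.eq_p (S : Spine G d p pr ht) (hG : G.IsTree) {v : V} (h : ht v = 0) :
    v = p (pr v) := by
  have h1 := S.proj v (pr v) (S.prle v)
  simp only [h, sub_self, abs_zero, Nat.cast_zero, add_zero] at h1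
  exact hG.1.dist_eq_zero_iff.1 (by omega)

lemma Spine.adj_iff (S : Spine G d p pr ht) {v : V} {j : ℕ} (hj : j ≤ d) :
    G.Adj v (p j) ↔ (ht v : ℤ) + |(j : ℤ) - pr v| = 1 := by
  rw [← dist_eq_one_iff_adj, ← S.proj v j hj]
  omega

lemma Spine.reverse (S : Spine G d p pr ht) :
    Spine G d (fun i => p (d - i)) (fun v => d - pr v) ht := by
  refine ⟨?_, ?_, ?_⟩
  · intro i hi
    have h := (S.adj (d - (i + 1)) (by omega)).symm
    have e : d - (i + 1) + 1 = d - i := by omega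
    rw [e] at h
    exact h
  · intro v
    omega
  · intro v j hj
    have h := S.proj v (d - j) (by omega)
    have h2 := S.prle v
    rw [h, abs_sub_comm]
    push_cast [Nat.cast_sub hj, Nat.cast_sub h2]
    congr 2
    ring

lemma exists_diam_spine (hG : G.IsTree) : ∃ d p pr ht, Spine G d p pr ht ∧
    ∀ v, ht v ≤ pr v ∧ pr v + ht v ≤ d := by
  have := hG.1.nonempty
  obtain ⟨⟨u, v⟩, -, huv⟩ := Finset.exists_max_image (Finset.univ : Finset (V × V))
    (fun x => G.dist x.1 x.2) Finset.univ_nonempty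
  obtain ⟨w, hw, hwl⟩ := hG.1.exists_path_of_dist u v
  obtain ⟨pr, ht, S⟩ := exists_spine hG w.getVert w.length
    (fun i hi => w.adj_getVert_succ hi) (by
      intro i hi h
      have := hw.getVert_injOn (by simp; omega) (by simp; omega) h
      omega)
  refine ⟨_, _, pr, ht, S, ?_⟩
  intro x
  have h0 := S.proj x 0 (by omega)
  have h1 := S.proj x w.length (by omega)
  have h2 := S.prle x
  have h3 := huv (x, w.getVert 0) (Finset.mem_univ _)
  have h4 := huv (x, w.getVert w.length) (Finset.mem_univ _)
  simp only at h3 h4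
  rw [abs_of_nonpos (by omega)] at h0
  rw [abs_of_nonneg (by omega)] at h1
  omega

/-- number of off-path neighbours of the `i`th vertex -/
noncomputable def offc (pr ht : V → ℕ) (i : ℕ) : ℕ :=
  (Finset.univ.filter fun v => ht v = 1 ∧ pr v = i).card

lemma Spine.degree (S : Spine G d p pr ht) (hG : G.IsTree) {i : ℕ} (h0 : 0 < i) (hi : i < d) :
    G.degree (p i) = 2 + offc pr ht i := by
  have h1 : G.neighborFinset (p i) =
      {p (i - 1), p (i + 1)} ∪ (Finset.univ.filter fun v => ht v = 1 ∧ pr v = i) := by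
    ext v
    simp only [mem_neighborFinset, Finset.mem_union, Finset.mem_insert, Finset.mem_singleton,
      Finset.mem_filter, Finset.mem_univ, true_and]
    rw [G.adj_comm, S.adj_iff hi.le]
    constructor
    · intro h
      by_cases hv : ht v = 0
      · left
        rw [S.eq_p hG hv]
        rw [hv] at h
        have : pr v = i - 1 ∨ pr v = i + 1 := by
          rcases abs_cases ((i : ℤ) - pr v) with h' | h' <;> omega
        rcases this with h | h <;> rw [h] <;> simp
      · right
        have := abs_nonneg ((i : ℤ) - pr v)
        have h2 : |(i : ℤ) - pr v| = 0 := by omega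
        have h3 := abs_eq_zero.1 h2
        omega
    · rintro ((h | h) | h)
      · have := S.pr_p (i := i - 1) (by omega)
        rw [h, this.1, this.2, abs_of_nonneg (by omega)]
        omega
      · have := S.pr_p (i := i + 1) (by omega)
        rw [h, this.1, this.2, abs_of_nonpos (by omega)]
        omega
      · rw [h.1, h.2]
        simp
  have h2 := S.pr_p (i := i - 1) (by omega)
  have h3 := S.pr_p (i := i + 1) (by omega)
  rw [← card_neighborFinset_eq_degree, h1, Finset.card_union_of_disjoint, Finset.card_pair]
  · rfl
  · intro h
    rw [h] at h2
    omega
  · rw [Finset.disjoint_left]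
    intro v hv hv2
    simp only [Finset.mem_insert, Finset.mem_singleton, Finset.mem_filter, Finset.mem_univ,
      true_and] at hv hv2
    rcases hv with rfl | rfl <;> omega

lemma Spine.sum_path (S : Spine G d p pr ht) (hG : G.IsTree) (f : V → ℤ) :
    ∑ v ∈ Finset.univ.filter (fun v => ht v = 0), f v = ∑ i ∈ Finset.range (d + 1), f (p i) := by
  symm
  apply Finset.sum_bij (fun i _ => p i)
  · intro i hi
    simp only [Finset.mem_range] at hi
    simp [(S.pr_p (i := i) (by omega)).2]
  · intro i hi j hj h
    simp only [Finset.mem_range] at hi hj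
    rw [← (S.pr_p (i := i) (by omega)).1, h, (S.pr_p (i := j) (by omega)).1]
  · intro v hv
    simp only [Finset.mem_filter, Finset.mem_univ, true_and] at hv
    refine ⟨pr v, ?_, (S.eq_p hG hv).symm⟩
    have := S.prle v
    simp
    omega
  · intros
    rfl

lemma sum_off (hb : ∀ v, ht v ≤ pr v ∧ pr v + ht v ≤ d) (g : ℕ → ℤ) :
    ∑ v ∈ Finset.univ.filter (fun v : V => ht v = 1), g (pr v) =
      ∑ i ∈ Finset.Ico 1 d, (offc pr ht i : ℤ) * g i := by
  rw [← Finset.sum_fiberwise_of_maps_to (t := Finset.Ico 1 d) (g := pr)]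
  · apply Finset.sum_congr rfl
    intro i hi
    rw [Finset.sum_congr rfl (g := fun _ => g i), Finset.sum_const, nsmul_eq_mul, offc,
      Finset.filter_filter]
    intro v hv
    rw [(Finset.mem_filter.1 hv).2]
  · intro v hv
    have h1 := (Finset.mem_filter.1 hv).2
    have := hb v
    simp
    omega

/-- distance to the nearer end -/
def mm (d i : ℕ) : ℤ := min (i : ℤ) (d - i)

/-- the deficiency -/
noncomputable def defi (d : ℕ) (pr ht : V → ℕ) : ℤ := ∑ v, (mm d (pr v) - ht v)

lemma Spine.distSum_eq (S : Spine G d p pr ht) {j : ℕ} (hj : j ≤ d) :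
    (distSum G (p j) : ℤ) = ∑ v, ((ht v : ℤ) + |(j : ℤ) - pr v|) := by
  unfold distSum
  push_cast
  exact Finset.sum_congr rfl fun v _ => S.proj v j hj

lemma Spine.distSum_add (S : Spine G d p pr ht) :
    (distSum G (p (d / 2)) : ℤ) + distSum G (p (d - d / 2)) =
      Fintype.card V * d - 2 * defi d pr ht := by
  rw [S.distSum_eq (by omega), S.distSum_eq (by omega), ← Finset.sum_add_distrib, defi,
    Finset.mul_sum]
  have : (Fintype.card V * d : ℤ) = ∑ v : V, (d : ℤ) := by simp
  rw [this, ← Finset.sum_sub_distrib]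
  apply Finset.sum_congr rfl
  intro v _
  have h1 := S.prle v
  unfold mm
  rcases abs_cases (((d / 2 : ℕ) : ℤ) - pr v) with h | h <;>
  rcases abs_cases (((d - d / 2 : ℕ) : ℤ) - pr v) with h' | h' <;>
  rcases min_cases (pr v : ℤ) ((d : ℤ) - pr v) with h'' | h'' <;> omega

/-- the main lower bound for the Mostar index in terms of the deficiency -/
lemma Spine.mostar_ge (S : Spine G d p pr ht) (hG : G.IsTree) :
    (Fintype.card V : ℤ) * (Fintype.card V - 1) - Fintype.card V * d + 2 * defi d pr ht
      ≤ mostar G := by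
  have h1 := _root_.mostar_ge hG (p (d / 2))
  have h2 := _root_.mostar_ge hG (p (d - d / 2))
  have h3 := S.distSum_add
  linarith

lemma Spine.defi_ge (S : Spine G d p pr ht) (hG : G.IsTree)
    (hb : ∀ v, ht v ≤ pr v ∧ pr v + ht v ≤ d) :
    ∑ i ∈ Finset.range (d + 1), mm d i +
      ∑ i ∈ Finset.Ico 1 d, (offc pr ht i : ℤ) * (mm d i - 1) ≤ defi d pr ht := by
  have h1 := S.sum_path hG (fun v => mm d (pr v) - ht v)
  have h2 := sum_off hb (fun i => mm d i - 1)
  have h3 : ∑ i ∈ Finset.range (d + 1), (mm d (pr (p i)) - ht (p i)) =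
      ∑ i ∈ Finset.range (d + 1), mm d i := by
    apply Finset.sum_congr rfl
    intro i hi
    simp only [Finset.mem_range] at hi
    have := S.pr_p (i := i) (by omega)
    rw [this.1, this.2]
    simp
  have h4 : ∑ v ∈ Finset.univ.filter (fun v : V => ht v = 1), (mm d (pr v) - 1) =
      ∑ v ∈ Finset.univ.filter (fun v : V => ht v = 1), (mm d (pr v) - ht v) := by
    apply Finset.sum_congr rfl
    intro v hv
    rw [(Finset.mem_filter.1 hv).2]
    simp
  rw [← h2, h4, ← h3, ← h1, ← Finset.sum_union]
  · unfold defi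
    apply Finset.sum_le_sum_of_subset_of_nonneg (Finset.subset_univ _)
    intro v _ _
    have := hb v
    unfold mm
    rcases min_cases (pr v : ℤ) ((d : ℤ) - pr v) with h'' | h'' <;> omega
  · rw [Finset.disjoint_left]
    intro v hv hv2
    simp only [Finset.mem_filter, Finset.mem_univ, true_and] at hv hv2
    omega

lemma sum_mm (d : ℕ) : 4 * ∑ i ∈ Finset.range (d + 1), mm d i = (d : ℤ) ^ 2 - ((d % 2 : ℕ) : ℤ) := by
  induction d using Nat.twoStepInduction with
  | zero => simp [mm]
  | one => simp [mm, Finset.sum_range_succ]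
  | more d ih _ =>
    rw [Finset.sum_range_succ, Finset.sum_range_succ']
    have : ∀ i ∈ Finset.range (d + 1), mm (d + 1 + 1) (i + 1) = mm d i + 1 := by
      intro i _
      unfold mm
      push_cast
      rw [← min_add_add_right]
      congr 1
      ring
    have h0 : mm (d + 1 + 1) 0 = 0 := by
      unfold mm
      push_cast
      rw [min_eq_left (by omega)]
    have h1 : mm (d + 1 + 1) (d + 1 + 1) = 0 := by
      unfold mm
      push_cast
      rw [min_eq_right (by omega)]
      ring
    rw [Finset.sum_congr rfl this, Finset.sum_add_distrib, h0, h1]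
    have e : (d + 1 + 1) % 2 = d % 2 := by omega
    simp only [Finset.sum_const, Finset.card_range, nsmul_eq_mul]
    rw [e]
    push_cast at ih ⊢
    linarith

lemma tri_bound (S : Finset ℕ) : (∀ i ∈ S, 1 ≤ i) → ∃ k : ℕ,
    2 * ∑ i ∈ S, ((i : ℤ) - 1) = (S.card : ℤ) * (S.card - 1) + 2 * k ∧
      (k = 0 → S = Finset.Icc 1 S.card) := by
  induction S using Finset.induction_on_max with
  | empty => exact fun _ => ⟨0, by simp⟩
  | insert a s ha ih =>
    intro h
    obtain ⟨k, hk, hk2⟩ := ih fun i hi => h i (Finset.mem_insert_of_mem hi)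
    have hns : a ∉ s := fun h => lt_irrefl _ (ha a h)
    have hc : s.card + 1 ≤ a := by
      have : s ⊆ Finset.Icc 1 (a - 1) := by
        intro i hi
        have h1 := ha i hi
        have h2 := h i (Finset.mem_insert_of_mem hi)
        simp
        omega
      have h3 := Finset.card_le_card this
      have h4 := h a (Finset.mem_insert_self _ _)
      simp at h3
      omega
    refine ⟨k + (a - (s.card + 1)), ?_, ?_⟩
    · rw [Finset.sum_insert hns, Finset.card_insert_of_notMem hns, mul_add, hk]
      push_cast [Nat.cast_sub hc]
      ring
    · intro h0
      have h1 : a = s.card + 1 := by omega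
      rw [Finset.card_insert_of_notMem hns]
      have h2 := hk2 (by omega)
      ext i
      rw [Finset.mem_insert]
      have h3 : i ∈ s ↔ i ∈ Finset.Icc 1 s.card := by rw [← h2]
      rw [h3]
      simp
      omega

/-- main combinatorial estimate -/
lemma pos_bound (d : ℕ) (hd : 1 ≤ d) (C : Finset ℕ) (hC : C ⊆ Finset.Ico 1 d) : ∃ k l : ℕ,
    4 * ∑ i ∈ C, (mm d i - 1) = (C.card : ℤ) ^ 2 - 2 * C.card +
      (((C.filter (fun i => 2 * i < d)).card : ℤ) - (C.filter (fun i => ¬ 2 * i < d)).card) ^ 2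
      + 4 * k + 4 * l ∧
    (k = 0 → C.filter (fun i => 2 * i < d) =
      Finset.Icc 1 (C.filter (fun i => 2 * i < d)).card) ∧
    (l = 0 → C.filter (fun i => ¬ 2 * i < d) =
      Finset.Icc (d - (C.filter (fun i => ¬ 2 * i < d)).card) (d - 1)) := by
  have hmem : ∀ i ∈ C, 1 ≤ i ∧ i < d := fun i hi => by simpa using hC hi
  obtain ⟨k, hk, hk2⟩ := tri_bound (C.filter (fun i => 2 * i < d)) (by
    intro i hi
    exact (hmem i (Finset.mem_filter.1 hi).1).1)
  set R := C.filter (fun i => ¬ 2 * i < d) with hR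
  have hRmem : ∀ i ∈ R, 1 ≤ i ∧ i < d ∧ ¬ 2 * i < d := by
    intro i hi
    have h1 := Finset.mem_filter.1 hi
    have := hmem i h1.1
    exact ⟨this.1, this.2, h1.2⟩
  have hinj : Set.InjOn (fun i => d - i) (R : Set ℕ) := by
    intro i hi j hj h
    have h1 := hRmem i hi
    have h2 := hRmem j hj
    simp only at h
    omega
  obtain ⟨l, hl, hl2⟩ := tri_bound (R.image (fun i => d - i)) (by
    intro i hi
    obtain ⟨j, hj, rfl⟩ := Finset.mem_image.1 hi
    have := hRmem j hj
    omega)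
  rw [Finset.card_image_of_injOn hinj, Finset.sum_image (by exact hinj)] at hl
  rw [Finset.card_image_of_injOn hinj] at hl2
  refine ⟨k, l, ?_, hk2, ?_⟩
  · have hcard := Finset.card_filter_add_card_filter_not (s := C) (fun i => 2 * i < d)
    rw [← Finset.sum_filter_add_sum_filter_not C (fun i => 2 * i < d)]
    have e1 : ∑ i ∈ C.filter (fun i => 2 * i < d), (mm d i - 1) =
        ∑ i ∈ C.filter (fun i => 2 * i < d), ((i : ℤ) - 1) := by
      apply Finset.sum_congr rfl
      intro i hi
      have := (Finset.mem_filter.1 hi).2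
      unfold mm
      rw [min_eq_left (by omega)]
    have e2 : ∑ i ∈ R, (mm d i - 1) = ∑ i ∈ R, (((d - i : ℕ) : ℤ) - 1) := by
      apply Finset.sum_congr rfl
      intro i hi
      have := hRmem i hi
      unfold mm
      rw [min_eq_right (by omega)]
      omega
    rw [e1, e2, ← hcard]
    push_cast
    linear_combination 2 * hk + 2 * hl
  · intro h0
    have h1 := hl2 h0
    ext i
    constructor
    · intro hi
      have h2 : d - i ∈ R.image (fun i => d - i) := Finset.mem_image_of_mem _ hi
      rw [h1] at h2
      have := hRmem i hi
      simp at h2 ⊢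
      omega
    · intro hi
      have h3 : R.card ≤ d - 1 := by
        have : R ⊆ Finset.Ico 1 d := by
          intro i hi
          have := hRmem i hi
          simp
          omega
        simpa using Finset.card_le_card this
      have h2 : d - i ∈ R.image (fun i => d - i) := by
        rw [h1]
        rw [Finset.mem_Icc] at hi ⊢
        omega
      obtain ⟨j, hj, hj2⟩ := Finset.mem_image.1 h2
      have := hRmem j hj
      rw [Finset.mem_Icc] at hi
      have : i = j := by omega
      rw [this]
      exact hj

end SpinePart

section ParentPart

lemma parent_adj {n : ℕ} {p : ℕ → ℕ} {u v : Fin n} :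
    (parentGraph n p).Adj u v ↔ u ≠ v ∧ (p u.val = v.val ∨ p v.val = u.val) := by
  unfold parentGraph
  rw [SimpleGraph.fromRel_adj]

lemma parent_connected {n : ℕ} {p : ℕ → ℕ} (hn : 0 < n) (hp : ∀ v, v ≠ 0 → p v < v) :
    (parentGraph n p).Connected := by
  have h : ∀ v : ℕ, ∀ hv : v < n, (parentGraph n p).Reachable ⟨v, hv⟩ ⟨0, hn⟩ := by
    intro v
    induction v using Nat.strong_induction_on with
    | _ v ih =>
      intro hv
      by_cases h0 : v = 0
      · subst h0
        exact Reachable.refl _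
      · have h1 := hp v h0
        refine Reachable.trans (Adj.reachable ?_) (ih (p v) h1 (by omega))
        rw [parent_adj]
        refine ⟨?_, Or.inl rfl⟩
        intro h
        have := congrArg Fin.val h
        simp at this
        omega
  have : Nonempty (Fin n) := ⟨⟨0, hn⟩⟩
  exact ⟨fun u v => (h u.1 u.2).trans (h v.1 v.2).symm⟩

lemma parent_edges {n : ℕ} {p : ℕ → ℕ} (h00 : p 0 = 0)
    (pf : Fin n → Fin n) (hpf : ∀ v, (pf v).val = p v.val) :
    (parentGraph n p).edgeFinset ⊆
      (Finset.univ.filter (fun v : Fin n => v.val ≠ 0)).image (fun v => s(v, pf v)) := by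
  intro e he
  induction e using Sym2.ind with
  | _ u v =>
    have huv : (parentGraph n p).Adj u v := by simpa using he
    rw [parent_adj] at huv
    rw [Finset.mem_image]
    obtain ⟨hne, h | h⟩ := huv
    · have hv : pf u = v := by
        ext
        rw [hpf, h]
      refine ⟨u, ?_, by rw [hv]⟩
      simp only [Finset.mem_filter, Finset.mem_univ, true_and]
      intro h0
      rw [h0, h00] at h
      apply hne
      ext
      omega
    · have hv : pf v = u := by
        ext
        rw [hpf, h]
      refine ⟨v, ?_, by rw [hv, Sym2.eq_swap]⟩
      simp only [Finset.mem_filter, Finset.mem_univ, true_and]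
      intro h0
      rw [h0, h00] at h
      apply hne
      ext
      omega

lemma parent_isTree {n : ℕ} {p : ℕ → ℕ} (hn : 0 < n) (h00 : p 0 = 0)
    (hp : ∀ v, v ≠ 0 → p v < v) (pf : Fin n → Fin n) (hpf : ∀ v, (pf v).val = p v.val) :
    (parentGraph n p).IsTree := by
  have hc := parent_connected hn hp
  rw [isTree_iff_connected_and_card]
  refine ⟨hc, ?_⟩
  have h1 := hc.card_vert_le_card_edgeSet_add_one
  have h2 := Finset.card_le_card (parent_edges h00 pf hpf)
  have h3 : (Finset.univ.filter (fun v : Fin n => v.val ≠ 0)).card ≤ n - 1 := by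
    have : (Finset.univ.filter (fun v : Fin n => v.val ≠ 0)) ⊆ Finset.univ.erase ⟨0, hn⟩ := by
      intro v hv
      simp only [Finset.mem_filter, Finset.mem_univ, true_and] at hv
      rw [Finset.mem_erase]
      refine ⟨?_, Finset.mem_univ _⟩
      intro h
      rw [h] at hv
      exact hv rfl
    have := Finset.card_le_card this
    simpa using this
  have h4 := h2.trans Finset.card_image_le
  rw [edgeFinset_card] at h4
  rw [Nat.card_eq_fintype_card] at h1 ⊢
  simp only [Nat.card_eq_fintype_card, Fintype.card_fin] at h1 ⊢
  omega

lemma card_fin_filter (n : ℕ) (P : ℕ → Prop) {i1 : DecidablePred (fun w : Fin n => P w.val)}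
    {i2 : DecidablePred P} :
    (@Finset.filter _ (fun w : Fin n => P w.val) i1 Finset.univ).card =
      (@Finset.filter _ P i2 (Finset.range n)).card := by
  rw [← Finset.card_map Fin.valEmbedding]
  congr 1
  ext i
  simp only [Finset.mem_map, Finset.mem_filter, Finset.mem_univ, true_and, Fin.valEmbedding_apply,
    Finset.mem_range]
  constructor
  · rintro ⟨w, hw, rfl⟩
    exact ⟨w.2, hw⟩
  · rintro ⟨h1, h2⟩
    exact ⟨⟨i, h1⟩, h2, rfl⟩

lemma psi_le {V : Type*} [Fintype V] {G : SimpleGraph V} (hG : G.IsTree) {u v : V}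
    (h : G.Adj u v) : (mostarPsi G s(u, v) : ℤ) ≤ Fintype.card V - 2 := by
  have h1 := sides_card hG h
  have h2 : 0 < (Finset.univ.filter fun w => G.dist w u < G.dist w v).card := by
    apply Finset.card_pos.2
    refine ⟨u, ?_⟩
    simp [hG.1.pos_dist_of_ne h.ne]
  have h3 : 0 < (Finset.univ.filter fun w => G.dist w v < G.dist w u).card := by
    apply Finset.card_pos.2
    refine ⟨v, ?_⟩
    simp [hG.1.pos_dist_of_ne h.ne']
  rw [mostarPsi_mk]
  omega

lemma Spine.psi_eq {V : Type*} [Fintype V] {G : SimpleGraph V} (hG : G.IsTree) {d : ℕ}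
    {p : ℕ → V} {pr ht : V → ℕ} (S : Spine G d p pr ht) {j : ℕ} (hj : j < d) :
    (mostarPsi G s(p (j + 1), p j) : ℤ) =
      |(Fintype.card V : ℤ) - 2 * (Finset.univ.filter fun w => pr w ≤ j).card| := by
  have h1 := sides_card hG (S.adj j hj)
  have h2 : (Finset.univ.filter fun w => G.dist w (p j) < G.dist w (p (j + 1))) =
      (Finset.univ.filter fun w => pr w ≤ j) := by
    ext w
    simp only [Finset.mem_filter, Finset.mem_univ, true_and]
    have e1 := S.proj w j hj.le
    have e2 := S.proj w (j + 1) hj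
    rcases abs_cases ((j : ℤ) - pr w) with h | h <;>
    rcases abs_cases (((j + 1 : ℕ) : ℤ) - pr w) with h' | h' <;> omega
  rw [h2] at h1
  rw [mostarPsi_mk, h2]
  push_cast
  rw [← h1]
  rw [abs_eq_abs]
  left
  push_cast
  ring

/-- parent function of `catF` -/
def cpar (n a b : ℕ) : ℕ → ℕ := fun v =>
    if v < n - a - b - 2 then v - 1
    else if v = n - a - b - 2 then 1
    else if v < n - b then v - (n - a - b - 2)
    else v - a - b - 3

lemma catF_eq (n a b : ℕ) : catF n a b = parentGraph n (cpar n a b) := rfl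

/-- projection in `catF` -/
def prF (n a b d : ℕ) : ℕ → ℕ := fun v => if v ≤ d then v else cpar n a b v

lemma cpar_lt {n a b t : ℕ} (hn : n = 2 * a + 2 * b + 5 + t) (v : ℕ) (hv : v ≠ 0) :
    cpar n a b v < v := by
  unfold cpar
  split_ifs <;> omega

/-- natural numbers as elements of `Fin n` -/
def toF (n : ℕ) (h : 0 < n) (i : ℕ) : Fin n := if hi : i < n then ⟨i, hi⟩ else ⟨0, h⟩

lemma toF_val {n : ℕ} (h : 0 < n) {i : ℕ} (hi : i < n) : (toF n h i).val = i := by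
  unfold toF
  rw [dif_pos hi]

lemma catF_isTree {n a b t : ℕ} (hn : n = 2 * a + 2 * b + 5 + t) : (catF n a b).IsTree := by
  rw [catF_eq]
  have h0 : 0 < n := by omega
  refine parent_isTree h0 ?_ (cpar_lt hn) (fun v => toF n h0 (cpar n a b v.val)) ?_
  · unfold cpar
    split_ifs <;> omega
  · intro v
    apply toF_val
    by_cases hv : v.val = 0
    · rw [hv]
      unfold cpar
      split_ifs <;> omega
    · have := cpar_lt hn v.val hv
      omega

lemma catF_adj_val {n a b t : ℕ} (hn : n = 2 * a + 2 * b + 5 + t) {v : Fin n} (hv : v.val ≠ 0)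
    {w : Fin n} (hw : w.val = cpar n a b v.val) : (catF n a b).Adj v w := by
  rw [catF_eq, parent_adj]
  refine ⟨?_, Or.inl hw.symm⟩
  intro h
  have := cpar_lt hn v.val hv
  rw [h] at this hw
  omega

lemma catF_spine {n a b t d : ℕ} (hn : n = 2 * a + 2 * b + 5 + t) (hd : d = a + b + 2 + t)
    (h0 : 0 < n) : ∃ pr ht, Spine (catF n a b) d (toF n h0) pr ht ∧
      ∀ w : Fin n, pr w = prF n a b d w.val := by
  have hT := catF_isTree hn
  obtain ⟨pr, ht, S⟩ := exists_spine hT (toF n h0) d (by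
      intro i hi
      refine (catF_adj_val hn ?_ ?_).symm
      · rw [toF_val h0 (by omega)]
        omega
      · rw [toF_val h0 (by omega), toF_val h0 (by omega)]
        unfold cpar
        rw [if_pos (by omega)]
        omega) (by
      intro i hi h
      have := congrArg Fin.val h
      rw [toF_val h0 (by omega), toF_val h0 (by omega)] at this
      omega)
  refine ⟨pr, ht, S, ?_⟩
  intro w
  unfold prF
  split_ifs with h
  · have : w = toF n h0 w.val := by
      ext
      rw [toF_val h0 w.2]
    conv_lhs => rw [this]
    exact (S.pr_p h).1
  · have hw := w.2
    have hle : cpar n a b w.val ≤ d := by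
      unfold cpar
      split_ifs <;> omega
    have h1 : (catF n a b).Adj w (toF n h0 (cpar n a b w.val)) := by
      apply catF_adj_val hn (by omega)
      rw [toF_val h0 (by omega)]
    rw [S.adj_iff hle] at h1
    have h2 : ht w ≠ 0 := by
      intro h3
      have h4 := congrArg Fin.val (S.eq_p hT h3)
      have h5 := S.prle w
      rw [toF_val h0 (by omega)] at h4
      omega
    rcases abs_cases ((cpar n a b w.val : ℤ) - pr w) with h' | h' <;> omega

lemma cL_left {n a b t d : ℕ} (hn : n = 2 * a + 2 * b + 5 + t) (hd : d = a + b + 2 + t)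
    {j : ℕ} (h1 : 1 ≤ j) (h2 : j ≤ a + 1) :
    ((Finset.range n).filter (fun v => prF n a b d v ≤ j)).card = 2 * j + 2 := by
  have : (Finset.range n).filter (fun v => prF n a b d v ≤ j) =
      Finset.Ico 0 (j + 1) ∪ Finset.Ico (d + 1) (d + 2 + j) := by
    ext v
    rw [Finset.mem_filter]
    simp only [Finset.mem_range, Finset.mem_union, Finset.mem_Ico]
    unfold prF cpar
    split_ifs <;> omega
  rw [this, Finset.card_union_of_disjoint]
  · simp
    omega
  · rw [Finset.disjoint_left]
    intro v
    simp only [Finset.mem_Ico]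
    omega

lemma cL_mid {n a b t d : ℕ} (hn : n = 2 * a + 2 * b + 5 + t) (hd : d = a + b + 2 + t)
    {j : ℕ} (h1 : a + 1 ≤ j) (h2 : j ≤ a + 1 + t) :
    ((Finset.range n).filter (fun v => prF n a b d v ≤ j)).card = j + a + 3 := by
  have : (Finset.range n).filter (fun v => prF n a b d v ≤ j) =
      Finset.Ico 0 (j + 1) ∪ Finset.Ico (d + 1) (d + a + 3) := by
    ext v
    rw [Finset.mem_filter]
    simp only [Finset.mem_range, Finset.mem_union, Finset.mem_Ico]
    unfold prF cpar
    split_ifs <;> omega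
  rw [this, Finset.card_union_of_disjoint]
  · simp
    omega
  · rw [Finset.disjoint_left]
    intro v
    simp only [Finset.mem_Ico]
    omega

lemma cL_right {n a b t d : ℕ} (hn : n = 2 * a + 2 * b + 5 + t) (hd : d = a + b + 2 + t)
    {j : ℕ} (h1 : a + 1 + t ≤ j) (h2 : j < d) :
    ((Finset.range n).filter (fun v => prF n a b d v ≤ j)).card + 2 * (d - j) = n + 1 := by
  have : (Finset.range n).filter (fun v => prF n a b d v ≤ j) =
      Finset.Ico 0 (j + 1) ∪ Finset.Ico (d + 1) (j + a + b + 4) := by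
    ext v
    rw [Finset.mem_filter]
    simp only [Finset.mem_range, Finset.mem_union, Finset.mem_Ico]
    unfold prF cpar
    split_ifs <;> omega
  rw [this, Finset.card_union_of_disjoint]
  · simp
    omega
  · rw [Finset.disjoint_left]
    intro v
    simp only [Finset.mem_Ico]
    omega

lemma sum_id_range (k : ℕ) : 2 * ∑ x ∈ Finset.range k, (x : ℤ) = k * (k - 1) := by
  induction k with
  | zero => simp
  | succ k ih =>
    rw [Finset.sum_range_succ, mul_add, ih]
    push_cast
    ring

lemma mid_sum1 (t : ℕ) : 2 * ∑ x ∈ Finset.range (t + 1), |(t : ℤ) + 1 - 2 * x| =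
    (t : ℤ) ^ 2 - ((t % 2 : ℕ) : ℤ) + 2 * (t + 1) := by
  induction t using Nat.twoStepInduction with
  | zero => simp
  | one => simp [Finset.sum_range_succ]
  | more t ih _ =>
    rw [Finset.sum_range_succ, Finset.sum_range_succ']
    have e : (t + 1 + 1) % 2 = t % 2 := by omega
    have e1 : ∀ x ∈ Finset.range (t + 1), |((t + 1 + 1 : ℕ) : ℤ) + 1 - 2 * ((x + 1 : ℕ) : ℤ)| =
      |(t : ℤ) + 1 - 2 * x| := by
      intro x _
      congr 1
      push_cast
      ring
    rw [Finset.sum_congr rfl e1, e]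
    rw [abs_of_nonneg (by push_cast; omega), abs_of_nonpos (by push_cast; omega)]
    push_cast at ih ⊢
    linarith

lemma mid_sum2 (t : ℕ) : ∑ x ∈ Finset.range (t + 1), |(t : ℤ) - 1 - 2 * x| =
    ∑ x ∈ Finset.range (t + 1), |(t : ℤ) + 1 - 2 * x| := by
  rw [← Finset.sum_range_reflect]
  apply Finset.sum_congr rfl
  intro x hx
  simp only [Finset.mem_range] at hx
  rw [← abs_neg]
  congr 1
  have : ((t + 1 - 1 - x : ℕ) : ℤ) = t - x := by omega
  rw [this]
  ring

lemma catF_mostar_le {n a b' t d : ℕ} (hn : n = 2 * a + 2 * (b' + 1) + 5 + t)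
    (hd : d = a + (b' + 1) + 2 + t) (hab : b' = a ∨ b' = a + 1) :
    (mostar (catF n a (b' + 1)) : ℤ) ≤ (n - 2) * (1 + (n - d)) +
      ∑ x ∈ Finset.range a, ((n : ℤ) - 8 - 4 * x) +
      ∑ x ∈ Finset.range (t + 1), |(t : ℤ) + 1 - 2 * x| +
      ∑ x ∈ Finset.range b', ((n : ℤ) - 4 * b' - 2 + 4 * x) := by
  have h0 : 0 < n := by omega
  have hT := catF_isTree hn
  obtain ⟨pr, ht, S, hpr⟩ := catF_spine hn hd h0
  set b := b' + 1 with hb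
  have h00 : cpar n a b 0 = 0 := by
    unfold cpar
    split_ifs <;> omega
  have hpfv : ∀ v : Fin n, (toF n h0 (cpar n a b v.val)).val = cpar n a b v.val := by
    intro v
    apply toF_val
    by_cases hv : v.val = 0
    · rw [hv, h00]
      exact h0
    · have := cpar_lt hn v.val hv
      omega
  set F : ℕ → ℤ := fun v => if v = 0 then 0 else
    (mostarPsi (catF n a b) s(toF n h0 v, toF n h0 (cpar n a b v)) : ℤ) with hF
  have hF0 : F 0 = 0 := by simp [hF]
  have hFle : ∀ v < n, F v ≤ n - 2 := by
    intro v hv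
    by_cases hv0 : v = 0
    · rw [hv0, hF0]
      omega
    · simp only [hF, if_neg hv0]
      have := psi_le hT (catF_adj_val hn (v := toF n h0 v) (w := toF n h0 (cpar n a b v))
        (by rw [toF_val h0 hv]; exact hv0) (by
          have := cpar_lt hn v hv0
          rw [toF_val h0 hv, toF_val h0 (by omega)]))
      simpa using this
  have hFspine : ∀ j < d, F (j + 1) = |(n : ℤ) -
      2 * ((Finset.range n).filter (fun v => prF n a b d v ≤ j)).card| := by
    intro j hj
    have e : cpar n a b (j + 1) = j := by
      unfold cpar
      rw [if_pos (by omega)]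
      omega
    simp only [hF, if_neg (Nat.succ_ne_zero j), e]
    rw [S.psi_eq hT hj]
    simp only [hpr, Fintype.card_fin]
    exact congrArg (fun x : ℕ => |(n : ℤ) - 2 * x|) (card_fin_filter n (fun v => prF n a b d v ≤ j))
  have hmo : (mostar (catF n a b) : ℤ) ≤ ∑ v ∈ Finset.range n, F v := by
    unfold mostar
    push_cast
    calc _ ≤ ∑ e ∈ (Finset.univ.filter (fun v : Fin n => v.val ≠ 0)).image
            (fun v => s(v, toF n h0 (cpar n a b v.val))), (mostarPsi (catF n a b) e : ℤ) := by
          refine Finset.sum_le_sum_of_subset_of_nonneg ?_ (fun _ _ _ => by positivity)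
          convert parent_edges h00 _ hpfv
          rfl
      _ ≤ ∑ v ∈ (Finset.univ.filter (fun v : Fin n => v.val ≠ 0)),
            (mostarPsi (catF n a b) s(v, toF n h0 (cpar n a b v.val)) : ℤ) := by
          apply Finset.sum_image_le_of_nonneg
          intros
          positivity
      _ = ∑ v : Fin n, F v.val := by
          rw [Finset.sum_filter]
          apply Finset.sum_congr rfl
          intro v _
          have : toF n h0 v.val = v := by
            ext
            rw [toF_val h0 v.2]
          by_cases hv : v.val = 0
          · simp [hF, hv]
          · simp only [hF, if_neg hv, this]
            rw [if_pos hv]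
      _ = _ := by rw [Fin.sum_univ_eq_sum_range]
  refine hmo.trans ?_
  have hsplit : n = 2 + a + (t + 1) + b' + (n - d) := by omega
  conv_lhs => rw [hsplit]
  rw [Finset.sum_range_add, Finset.sum_range_add, Finset.sum_range_add, Finset.sum_range_add]
  have s1 : ∑ v ∈ Finset.range 2, F v ≤ n - 2 := by
    rw [Finset.sum_range_succ, Finset.sum_range_one, hF0]
    have := hFle 1 (by omega)
    omega
  have s2 : ∑ x ∈ Finset.range a, F (2 + x) ≤ ∑ x ∈ Finset.range a, ((n : ℤ) - 8 - 4 * x) := by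
    apply Finset.sum_le_sum
    intro x hx
    simp only [Finset.mem_range] at hx
    have e : 2 + x = (1 + x) + 1 := by omega
    rw [e, hFspine (1 + x) (by omega), cL_left hn hd (by omega) (by omega)]
    rw [abs_of_nonneg (by push_cast; omega)]
    push_cast
    omega
  have s3 : ∑ x ∈ Finset.range (t + 1), F (2 + a + x) ≤
      ∑ x ∈ Finset.range (t + 1), |(t : ℤ) + 1 - 2 * x| := by
    have s3' : ∀ x ∈ Finset.range (t + 1), F (2 + a + x) = |(t : ℤ) + 2 * b' - 2 * a - 1 - 2 * x| := by
      intro x hx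
      simp only [Finset.mem_range] at hx
      have e : 2 + a + x = (1 + a + x) + 1 := by omega
      rw [e, hFspine (1 + a + x) (by omega), cL_mid hn hd (by omega) (by omega)]
      congr 1
      push_cast
      omega
    rw [Finset.sum_congr rfl s3']
    rcases hab with h | h
    · rw [← mid_sum2]
      apply le_of_eq
      apply Finset.sum_congr rfl
      intro x _
      congr 1
      rw [h]
      ring
    · apply le_of_eq
      apply Finset.sum_congr rfl
      intro x _
      congr 1
      rw [h]
      push_cast
      ring
  have s4 : ∑ x ∈ Finset.range b', F (2 + a + (t + 1) + x) ≤
      ∑ x ∈ Finset.range b', ((n : ℤ) - 4 * b' - 2 + 4 * x) := by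
    apply Finset.sum_le_sum
    intro x hx
    simp only [Finset.mem_range] at hx
    have e : 2 + a + (t + 1) + x = (2 + a + t + x) + 1 := by omega
    have e2 := cL_right hn hd (j := 2 + a + t + x) (by omega) (by omega)
    rw [e, hFspine (2 + a + t + x) (by omega)]
    rw [abs_of_nonpos (by omega)]
    omega
  have s5 : ∑ x ∈ Finset.range (n - d), F (2 + a + (t + 1) + b' + x) ≤ (n - 2) * (n - d) := by
    have : ∑ x ∈ Finset.range (n - d), F (2 + a + (t + 1) + b' + x) ≤
        ∑ x ∈ Finset.range (n - d), ((n : ℤ) - 2) := by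
      apply Finset.sum_le_sum
      intro x hx
      simp only [Finset.mem_range] at hx
      apply hFle
      omega
    refine this.trans ?_
    rw [Finset.sum_const, Finset.card_range, nsmul_eq_mul, Nat.cast_sub (by omega), mul_comm]
  have e6 : ((n : ℤ) - 2) * (1 + (n - d)) = (n - 2) + (n - 2) * (n - d) := by ring
  rw [e6]
  linarith

lemma catF_mostar_one {n a t d : ℕ} (hn : n = 4 * a + 7 + t) (hd : d = 2 * a + 3 + t) :
    2 * ((mostar (catF n a (a + 1)) : ℤ) - n * (n - 1) + n * d) ≤
      (d : ℤ) ^ 2 + ((d % 2 : ℕ) : ℤ) + (2 * a + 2) ^ 2 - 2 * (2 * a + 2) := by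
  have h := catF_mostar_le (n := n) (a := a) (b' := a) (t := t) (d := d) (by omega) (by omega)
    (Or.inl rfl)
  have h1 := mid_sum1 t
  have h2 := sum_id_range a
  rw [Finset.sum_sub_distrib, Finset.sum_add_distrib, ← Finset.mul_sum] at h
  simp only [Finset.sum_const, Finset.card_range, nsmul_eq_mul] at h
  have h3 : ((d % 2 : ℕ) : ℤ) = 1 - ((t % 2 : ℕ) : ℤ) := by omega
  rw [h3]
  have hn' : (n : ℤ) = 4 * a + 7 + t := by omega
  have hd' : (d : ℤ) = 2 * a + 3 + t := by omega
  rw [hn', hd'] at h ⊢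
  nlinarith

lemma catF_mostar_two {n a t d : ℕ} (hn : n = 4 * a + 9 + t) (hd : d = 2 * a + 4 + t) :
    2 * ((mostar (catF n a (a + 2)) : ℤ) - n * (n - 1) + n * d) ≤
      (d : ℤ) ^ 2 - ((d % 2 : ℕ) : ℤ) + (2 * a + 3) ^ 2 - 2 * (2 * a + 3) + 1 := by
  have h := catF_mostar_le (n := n) (a := a) (b' := a + 1) (t := t) (d := d) (by omega) (by omega)
    (Or.inr rfl)
  have h1 := mid_sum1 t
  have h2 := sum_id_range a
  have h4 := sum_id_range (a + 1)
  rw [Finset.sum_sub_distrib, Finset.sum_add_distrib, ← Finset.mul_sum, ← Finset.mul_sum] at h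
  simp only [Finset.sum_const, Finset.card_range, nsmul_eq_mul] at h
  have h3 : ((d % 2 : ℕ) : ℤ) = ((t % 2 : ℕ) : ℤ) := by omega
  rw [h3]
  have hn' : (n : ℤ) = 4 * a + 9 + t := by omega
  have hd' : (d : ℤ) = 2 * a + 4 + t := by omega
  push_cast at h h4
  rw [hn', hd'] at h ⊢
  nlinarith

lemma degree_ncard {V : Type*} [Fintype V] (G : SimpleGraph V) (v : V) :
    G.degree v = (Finset.univ.filter fun w => G.Adj v w).card := by
  rw [← card_neighborFinset_eq_degree]
  congr 1
  ext w
  simp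

lemma catF_degreeTwo {n a b t : ℕ} (hn : n = 2 * a + 2 * b + 5 + t) :
    degreeTwoCount (catF n a b) = t := by
  have h0 : 0 < n := by omega
  unfold degreeTwoCount
  have key : ∀ v : Fin n, ((catF n a b).degree v = 2 ↔ a + 2 ≤ v.val ∧ v.val < a + 2 + t) := by
    intro v
    have hv := v.2
    have hadj : ∀ w : Fin n, (catF n a b).Adj v w ↔
        v ≠ w ∧ (cpar n a b v.val = w.val ∨ cpar n a b w.val = v.val) := by
      intro w
      rw [catF_eq, parent_adj]
    rw [degree_ncard]
    by_cases hm : a + 2 ≤ v.val ∧ v.val < a + 2 + t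
    · simp only [hm, and_self, iff_true]
      have : (Finset.univ.filter fun w => (catF n a b).Adj v w) =
          {toF n h0 (v.val - 1), toF n h0 (v.val + 1)} := by
        ext w
        have hw := w.2
        simp only [Finset.mem_filter, Finset.mem_univ, true_and, Finset.mem_insert,
          Finset.mem_singleton, hadj]
        rw [Fin.ext_iff, Fin.ext_iff, toF_val h0 (by omega), toF_val h0 (by omega), ne_eq,
          Fin.ext_iff]
        unfold cpar
        split_ifs <;> omega
      rw [this, Finset.card_pair]
      rw [ne_eq, Fin.ext_iff, toF_val h0 (by omega), toF_val h0 (by omega)]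
      omega
    · simp only [hm, iff_false]
      by_cases hl : v.val = 0 ∨ a + b + 2 + t ≤ v.val
      · have : (Finset.univ.filter fun w => (catF n a b).Adj v w) ⊆
            {toF n h0 (if v.val = 0 then 1 else cpar n a b v.val)} := by
          intro w
          have hw := w.2
          simp only [Finset.mem_filter, Finset.mem_univ, true_and,
            Finset.mem_singleton, hadj]
          rw [Fin.ext_iff, ne_eq, Fin.ext_iff]
          by_cases hv0 : v.val = 0
          · rw [if_pos hv0, toF_val h0 (by omega)]
            unfold cpar
            split_ifs <;> omega
          · rw [if_neg hv0, toF_val h0 (by have := cpar_lt hn v.val hv0; omega)]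
            unfold cpar
            split_ifs <;> omega
        have := Finset.card_le_card this
        simp only [Finset.card_singleton] at this
        omega
      · set q := if v.val ≤ a + 1 then v.val + (n - a - b - 2) else v.val + a + b + 3 with hq
        have hqn : q < n := by
          rw [hq]
          split_ifs <;> omega
        have : ({toF n h0 (v.val - 1), toF n h0 (v.val + 1), toF n h0 q} : Finset (Fin n)) ⊆
            (Finset.univ.filter fun w => (catF n a b).Adj v w) := by
          intro w
          have hw := w.2
          simp only [Finset.mem_filter, Finset.mem_univ, true_and, Finset.mem_insert,
            Finset.mem_singleton, hadj]
          rw [Fin.ext_iff, Fin.ext_iff, Fin.ext_iff, toF_val h0 (by omega), toF_val h0 (by omega),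
            toF_val h0 hqn, ne_eq, Fin.ext_iff]
          rw [hq]
          unfold cpar
          split_ifs <;> omega
        have := Finset.card_le_card this
        rw [Finset.card_insert_of_notMem, Finset.card_pair] at this
        · omega
        · rw [ne_eq, Fin.ext_iff, toF_val h0 (by omega), toF_val h0 (by omega), hq]
          split_ifs <;> omega
        · simp only [Finset.mem_insert, Finset.mem_singleton]
          rw [Fin.ext_iff, Fin.ext_iff, toF_val h0 (by omega), toF_val h0 (by omega),
            toF_val h0 (by omega), hq]
          split_ifs <;> omega
  simp only [key]
  refine (card_fin_filter n (fun v => a + 2 ≤ v ∧ v < a + 2 + t)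
    (i2 := fun _ => inferInstance)).trans ?_
  have : (Finset.range n).filter (fun v => a + 2 ≤ v ∧ v < a + 2 + t) =
      Finset.Ico (a + 2) (a + 2 + t) := by
    ext v
    simp only [Finset.mem_filter, Finset.mem_range, Finset.mem_Ico]
    omega
  rw [this]
  simp

end ParentPart

section CountPart
variable {V : Type*} [Fintype V] {G : SimpleGraph V} {d : ℕ} {p : ℕ → V} {pr ht : V → ℕ}

lemma tree_degree_pos (hG : G.IsTree) (hn : 2 ≤ Fintype.card V) (v : V) : 1 ≤ G.degree v := by
  have : Nontrivial V := Fintype.one_lt_card_iff_nontrivial.1 (by omega)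
  exact hG.1.preconnected.degree_pos_of_nontrivial v

lemma tree_sum_degree (hG : G.IsTree) :
    (∑ v, (G.degree v : ℤ)) = 2 * Fintype.card V - 2 := by
  have h1 := G.sum_degrees_eq_twice_card_edges
  have h2 := hG.card_edgeFinset
  have h3 : ((∑ v, G.degree v : ℕ) : ℤ) = ((2 * #G.edgeFinset : ℕ) : ℤ) := by
    rw [h1]
  push_cast at h3
  rw [h3]
  omega

/-- the excess over the vertices which are not leaves -/
lemma nonleaf_sum (hG : G.IsTree) (hn : 2 ≤ Fintype.card V) :
    ∑ v ∈ Finset.univ.filter (fun v => 2 ≤ G.degree v), ((G.degree v : ℤ) - 1) =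
      Fintype.card V - 2 := by
  have h1 : ∑ v ∈ Finset.univ.filter (fun v => 2 ≤ G.degree v), ((G.degree v : ℤ) - 1) =
      ∑ v, ((G.degree v : ℤ) - 1) := by
    apply Finset.sum_subset (Finset.subset_univ _)
    intro v _ hv
    have := tree_degree_pos hG hn v
    simp only [Finset.mem_filter, Finset.mem_univ, true_and] at hv
    omega
  rw [h1, Finset.sum_sub_distrib, tree_sum_degree hG]
  simp
  ring

lemma nonleaf_card (hG : G.IsTree) (hn : 2 ≤ Fintype.card V) :
    2 * (Finset.univ.filter (fun v => 2 ≤ G.degree v)).card + 2 ≤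
      Fintype.card V + degreeTwoCount G := by
  have h1 := nonleaf_sum hG hn
  have h2 : ∑ v ∈ Finset.univ.filter (fun v => 2 ≤ G.degree v),
      ((2 : ℤ) - if G.degree v = 2 then 1 else 0) ≤
      ∑ v ∈ Finset.univ.filter (fun v => 2 ≤ G.degree v), ((G.degree v : ℤ) - 1) := by
    apply Finset.sum_le_sum
    intro v hv
    have := (Finset.mem_filter.1 hv).2
    split_ifs <;> omega
  rw [Finset.sum_sub_distrib, Finset.sum_const, Finset.sum_boole, Finset.filter_filter, h1] at h2
  have h3 : (Finset.univ.filter (fun v => 2 ≤ G.degree v ∧ G.degree v = 2)).card =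
      degreeTwoCount G := by
    unfold degreeTwoCount
    congr 1
    ext v
    simp only [Finset.mem_filter, Finset.mem_univ, true_and]
    omega
  rw [h3] at h2
  simp only [nsmul_eq_mul] at h2
  omega

lemma Spine.p_injOn (S : Spine G d p pr ht) {s : Finset ℕ} (hs : s ⊆ Finset.Ico 1 d) :
    Set.InjOn p (s : Set ℕ) := by
  intro i hi j hj h
  have h1 := Finset.mem_Ico.1 (hs hi)
  have h2 := Finset.mem_Ico.1 (hs hj)
  rw [← (S.pr_p (i := i) (by omega)).1, h, (S.pr_p (i := j) (by omega)).1]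

lemma Spine.interior_subset (S : Spine G d p pr ht) (hG : G.IsTree) :
    (Finset.Ico 1 d).image p ⊆ Finset.univ.filter (fun v => 2 ≤ G.degree v) := by
  intro v hv
  obtain ⟨i, hi, rfl⟩ := Finset.mem_image.1 hv
  have h1 := Finset.mem_Ico.1 hi
  simp only [Finset.mem_filter, Finset.mem_univ, true_and]
  rw [S.degree hG (by omega) h1.2]
  omega

lemma Spine.interior_card (S : Spine G d p pr ht) : ((Finset.Ico 1 d).image p).card = d - 1 := by
  rw [Finset.card_image_of_injOn (S.p_injOn (Finset.Subset.refl _))]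
  simp

lemma Spine.d_le (S : Spine G d p pr ht) (hG : G.IsTree) (hn : 2 ≤ Fintype.card V) :
    2 * d ≤ Fintype.card V + degreeTwoCount G := by
  have h1 := nonleaf_card hG hn
  have h2 := Finset.card_le_card (S.interior_subset hG)
  rw [S.interior_card] at h2
  omega

/-- positions of path vertices of degree at least three -/
noncomputable def brC (d : ℕ) (pr ht : V → ℕ) : Finset ℕ :=
  (Finset.Ico 1 d).filter (fun i => 1 ≤ offc pr ht i)

lemma brC_sub : brC d pr ht ⊆ Finset.Ico 1 d := Finset.filter_subset _ _

lemma brC_compl_card (hd : 1 ≤ d) : (brC d pr ht).card +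
    ((Finset.Ico 1 d).filter (fun i => ¬ 1 ≤ offc pr ht i)).card + 1 = d := by
  have := Finset.card_filter_add_card_filter_not (s := Finset.Ico 1 d)
    (fun i => 1 ≤ offc pr ht i)
  unfold brC
  rw [this]
  simp
  omega

lemma Spine.brC_card_ge (S : Spine G d p pr ht) (hG : G.IsTree) (hd : 1 ≤ d) :
    d ≤ (brC d pr ht).card + 1 + degreeTwoCount G := by
  have h1 := brC_compl_card (pr := pr) (ht := ht) hd
  have h2 : (((Finset.Ico 1 d).filter (fun i => ¬ 1 ≤ offc pr ht i)).image p) ⊆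
      Finset.univ.filter (fun v => G.degree v = 2) := by
    intro v hv
    obtain ⟨i, hi, rfl⟩ := Finset.mem_image.1 hv
    obtain ⟨hi1, hi2⟩ := Finset.mem_filter.1 hi
    have hi1 := Finset.mem_Ico.1 hi1
    simp only [Finset.mem_filter, Finset.mem_univ, true_and]
    rw [S.degree hG (by omega) hi1.2]
    omega
  have h3 := Finset.card_le_card h2
  rw [Finset.card_image_of_injOn (S.p_injOn (Finset.filter_subset _ _))] at h3
  unfold degreeTwoCount
  omega

lemma Spine.struct (S : Spine G d p pr ht) (hG : G.IsTree) (hn : 2 ≤ Fintype.card V)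
    (hb : ∀ v, ht v ≤ pr v ∧ pr v + ht v ≤ d) (hd1 : 1 ≤ d)
    (hd : 2 * d + 1 = Fintype.card V + degreeTwoCount G) :
    (∀ v, ht v ≤ 1) ∧
    (∑ i ∈ Finset.Ico 1 d, (offc pr ht i : ℤ) = Fintype.card V - 1 - d) ∧
    (brC d pr ht).card + 1 + degreeTwoCount G = d := by
  have h1 := nonleaf_card hG hn
  have hN : (Finset.Ico 1 d).image p = Finset.univ.filter (fun v => 2 ≤ G.degree v) := by
    apply Finset.eq_of_subset_of_card_le (S.interior_subset hG)
    rw [S.interior_card]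
    omega
  have h2 := nonleaf_sum hG hn
  rw [← hN, Finset.sum_image (S.p_injOn (Finset.Subset.refl _))] at h2
  have h3 : ∑ i ∈ Finset.Ico 1 d, ((G.degree (p i) : ℤ) - 1) =
      ∑ i ∈ Finset.Ico 1 d, ((offc pr ht i : ℤ) + 1) := by
    apply Finset.sum_congr rfl
    intro i hi
    have hi := Finset.mem_Ico.1 hi
    rw [S.degree hG (by omega) hi.2]
    push_cast
    ring
  rw [h3, Finset.sum_add_distrib] at h2
  simp only [Finset.sum_const, Nat.card_Ico, nsmul_eq_mul, mul_one] at h2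
  have hsum : ∑ i ∈ Finset.Ico 1 d, (offc pr ht i : ℤ) = Fintype.card V - 1 - d := by
    rw [Nat.cast_sub hd1] at h2
    push_cast at h2
    linarith
  refine ⟨?_, hsum, ?_⟩
  · have h4 := S.sum_path hG (fun _ => 1)
    have h5 := sum_off (V := V) hb (fun _ => 1)
    simp only [mul_one] at h5
    rw [hsum] at h5
    simp only [Finset.sum_const, Finset.card_range, nsmul_eq_mul, mul_one] at h4 h5
    have h6 : (Finset.univ.filter (fun v : V => ht v = 0) ∪
        Finset.univ.filter (fun v : V => ht v = 1)) = Finset.univ := by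
      apply Finset.eq_of_subset_of_card_le (Finset.subset_univ _)
      rw [Finset.card_union_of_disjoint, Finset.card_univ]
      · omega
      · rw [Finset.disjoint_left]
        intro v hv hv2
        have := (Finset.mem_filter.1 hv).2
        have := (Finset.mem_filter.1 hv2).2
        omega
    intro v
    have h7 : v ∈ (Finset.univ.filter (fun v : V => ht v = 0) ∪
        Finset.univ.filter (fun v : V => ht v = 1)) := by
      rw [h6]
      exact Finset.mem_univ v
    simp only [Finset.mem_union, Finset.mem_filter, Finset.mem_univ, true_and] at h7
    omega
  · have h4 := S.brC_card_ge hG hd1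
    have h5 := brC_compl_card (pr := pr) (ht := ht) hd1
    have h6 : Finset.univ.filter (fun v => G.degree v = 2) ⊆
        (((Finset.Ico 1 d).filter (fun i => ¬ 1 ≤ offc pr ht i)).image p) := by
      intro v hv
      have hv := (Finset.mem_filter.1 hv).2
      have h7 : v ∈ (Finset.Ico 1 d).image p := by
        rw [hN]
        simp [hv]
      obtain ⟨i, hi, rfl⟩ := Finset.mem_image.1 h7
      apply Finset.mem_image_of_mem
      rw [Finset.mem_filter]
      refine ⟨hi, ?_⟩
      have hi := Finset.mem_Ico.1 hi
      rw [S.degree hG (by omega) hi.2] at hv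
      omega
    have h7 := (Finset.card_le_card h6).trans Finset.card_image_le
    unfold degreeTwoCount at h4 ⊢
    omega

lemma mm_pos {i : ℕ} (hi : i ∈ Finset.Ico 1 d) : 1 ≤ mm d i := by
  have := Finset.mem_Ico.1 hi
  unfold mm
  rw [le_min_iff]
  omega

lemma off_split : ∑ i ∈ Finset.Ico 1 d, (offc pr ht i : ℤ) * (mm d i - 1) =
    ∑ i ∈ brC d pr ht, (mm d i - 1) +
      ∑ i ∈ brC d pr ht, ((offc pr ht i : ℤ) - 1) * (mm d i - 1) := by
  rw [← Finset.sum_add_distrib]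
  rw [← Finset.sum_subset (brC_sub (d := d) (pr := pr) (ht := ht))]
  · apply Finset.sum_congr rfl
    intro i _
    ring
  · intro i hi hi2
    have : offc pr ht i = 0 := by
      by_contra h
      apply hi2
      unfold brC
      rw [Finset.mem_filter]
      exact ⟨hi, by omega⟩
    rw [this]
    simp

lemma Spine.short_bound (S : Spine G d p pr ht) (hG : G.IsTree) (hd1 : 1 ≤ d)
    (hb : ∀ v, ht v ≤ pr v ∧ pr v + ht v ≤ d) :
    (d : ℤ) ^ 2 - 1 + ((brC d pr ht).card : ℤ) ^ 2 - 2 * (brC d pr ht).card ≤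
      2 * ((mostar G : ℤ) - Fintype.card V * (Fintype.card V - 1) + Fintype.card V * d) := by
  have h1 := S.mostar_ge hG
  have h2 := S.defi_ge hG hb
  have h3 := sum_mm d
  obtain ⟨k, l, h4, -, -⟩ := pos_bound d hd1 (brC d pr ht) brC_sub
  have h5 := off_split (d := d) (pr := pr) (ht := ht)
  have h6 : 0 ≤ ∑ i ∈ brC d pr ht, ((offc pr ht i : ℤ) - 1) * (mm d i - 1) := by
    apply Finset.sum_nonneg
    intro i hi
    have h7 := mm_pos (brC_sub hi)
    have h8 := (Finset.mem_filter.1 hi).2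
    apply mul_nonneg <;> omega
  have h7 : ((d % 2 : ℕ) : ℤ) ≤ 1 := by omega
  have h8 := sq_nonneg ((((brC d pr ht).filter (fun i => 2 * i < d)).card : ℤ) -
    ((brC d pr ht).filter (fun i => ¬ 2 * i < d)).card)
  have hk : (0 : ℤ) ≤ k := by positivity
  have hl : (0 : ℤ) ≤ l := by positivity
  linarith

/-- the path has the maximum possible length -/
lemma short_contra {n t d ds e r rs : ℕ} {M F : ℤ} (hn : n = ds + rs + 2) (hds : ds = rs + 1 + t)
    (hrs : 2 ≤ rs) (hde : ds = d + e) (he : 1 ≤ e) (hr : d ≤ r + 1 + t)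
    (h1 : (d : ℤ) ^ 2 - 1 + (r : ℤ) ^ 2 - 2 * r ≤ 2 * (M - n * (n - 1) + n * d))
    (h2 : 2 * (F - n * (n - 1) + n * ds) ≤ (ds : ℤ) ^ 2 + 1 + (rs : ℤ) ^ 2 - 2 * rs)
    (hMF : M ≤ F) : False := by
  have hn' : (n : ℤ) = d + e + rs + 2 := by omega
  have hds' : (ds : ℤ) = d + e := by omega
  rw [hds'] at h2
  have h3 : 2 * (n : ℤ) * e - (2 * d * e + e ^ 2) - (rs ^ 2 - 2 * rs) + (r ^ 2 - 2 * r) ≤ 2 := by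
    linarith
  rw [hn'] at h3
  have he' : (1 : ℤ) ≤ e := by omega
  have hrs' : (2 : ℤ) ≤ rs := by omega
  by_cases hc : e + 1 ≤ rs
  · obtain ⟨q, hq⟩ : ∃ q, rs = e + 1 + q := ⟨rs - (e + 1), by omega⟩
    have hq' : (rs : ℤ) = e + 1 + q := by omega
    have hr' : (q : ℤ) + 1 ≤ r := by omega
    rw [hq'] at h3
    have h4 : (0 : ℤ) ≤ (r - (q + 1)) * (r + q - 1) := by
      apply mul_nonneg <;> omega
    have h5 := sq_nonneg (e : ℤ)
    clear h1 h2
    linarith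
  · have hc' : (rs : ℤ) ≤ e := by omega
    have h4 := sq_nonneg ((r : ℤ) - 1)
    have h5 := mul_le_mul_of_nonneg_right hc' (show (0 : ℤ) ≤ rs by omega)
    have h6 := sq_nonneg (e : ℤ)
    have h7 := sq_nonneg (rs : ℤ)
    clear h1 h2
    linarith

end CountPart
section ShapePart
variable {V : Type*} [Fintype V] {G : SimpleGraph V} {d : ℕ} {p : ℕ → V} {pr ht : V → ℕ}

lemma sum_one_elim {C : Finset ℕ} {f : ℕ → ℤ} (h0 : ∀ i ∈ C, 0 ≤ f i) (h : ∑ i ∈ C, f i = 1) :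
    ∃ x ∈ C, f x = 1 ∧ ∀ i ∈ C, i ≠ x → f i = 0 := by
  obtain ⟨x, hx, hfx⟩ := Finset.exists_ne_zero_of_sum_ne_zero (s := C) (f := f) (by omega)
  have h1 := h0 x hx
  rw [← Finset.add_sum_erase C f hx] at h
  have h2 : ∀ i ∈ C.erase x, 0 ≤ f i := fun i hi => h0 i (Finset.mem_of_mem_erase hi)
  have h3 := Finset.sum_nonneg h2
  have h4 : ∑ i ∈ C.erase x, f i = 0 := by omega
  refine ⟨x, hx, by omega, ?_⟩
  intro i hi hix
  exact (Finset.sum_eq_zero_iff_of_nonneg h2).1 h4 i (Finset.mem_erase.2 ⟨hix, hi⟩)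

lemma brC_sum : ∑ i ∈ brC d pr ht, (offc pr ht i : ℤ) =
    ∑ i ∈ Finset.Ico 1 d, (offc pr ht i : ℤ) := by
  apply Finset.sum_subset brC_sub
  intro i hi hi2
  have : ¬ 1 ≤ offc pr ht i := fun h => hi2 (Finset.mem_filter.2 ⟨hi, h⟩)
  omega

lemma Spine.special (S : Spine G d p pr ht) (hG : G.IsTree) (hn : 2 ≤ Fintype.card V)
    (hb : ∀ v, ht v ≤ pr v ∧ pr v + ht v ≤ d) (hd1 : 1 ≤ d)
    (hd : 2 * d + 1 = Fintype.card V + degreeTwoCount G) :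
    ∃ x ∈ Finset.Ico 1 d, offc pr ht x = 2 ∧ (∀ i ∈ brC d pr ht, i ≠ x → offc pr ht i = 1) ∧
      ∑ i ∈ brC d pr ht, ((offc pr ht i : ℤ) - 1) * (mm d i - 1) = mm d x - 1 := by
  obtain ⟨h1, h2, h3⟩ := S.struct hG hn hb hd1 hd
  have h4 : ∑ i ∈ brC d pr ht, ((offc pr ht i : ℤ) - 1) = 1 := by
    rw [Finset.sum_sub_distrib, brC_sum, h2]
    simp
    omega
  obtain ⟨x, hx, hfx, ho⟩ := sum_one_elim (by
    intro i hi
    have := (Finset.mem_filter.1 hi).2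
    omega) h4
  refine ⟨x, brC_sub hx, by omega, ?_, ?_⟩
  · intro i hi hix
    have := ho i hi hix
    omega
  · rw [Finset.sum_eq_single x]
    · rw [hfx, one_mul]
    · intro i hi hix
      rw [ho i hi hix, zero_mul]
    · exact fun h => absurd hx h

lemma sq_le_two_elim {x : ℤ} (h : x ^ 2 ≤ 2) : x ≤ 1 ∧ -1 ≤ x := by
  constructor <;> nlinarith

/-- shape of an extremal tree -/
structure Shape (d : ℕ) (pr ht : V → ℕ) (x al be : ℕ) : Prop where
  ht1 : ∀ v, ht v ≤ 1
  xpos : x = 1 ∨ x = d - 1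
  xmem : x ∈ Finset.Ico 1 d
  x2 : offc pr ht x = 2
  oth : ∀ i ∈ brC d pr ht, i ≠ x → offc pr ht i = 1
  left : (brC d pr ht).filter (fun i => 2 * i < d) = Finset.Icc 1 al
  right : (brC d pr ht).filter (fun i => ¬ 2 * i < d) = Finset.Icc (d - be) (d - 1)
  sum : al + be = (brC d pr ht).card
  close1 : al ≤ be + 1
  close2 : be ≤ al + 1
  hdefi : (d : ℤ) ^ 2 - ((d % 2 : ℕ) : ℤ) + ((al : ℤ) + be) ^ 2 - 2 * (al + be) +
    ((al : ℤ) - be) ^ 2 ≤ 4 * defi d pr ht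

lemma Spine.shape (S : Spine G d p pr ht) (hG : G.IsTree) (hn : 2 ≤ Fintype.card V)
    (hb : ∀ v, ht v ≤ pr v ∧ pr v + ht v ≤ d) (hd1 : 1 ≤ d)
    (hd : 2 * d + 1 = Fintype.card V + degreeTwoCount G)
    (hs : 2 * ((mostar G : ℤ) - Fintype.card V * (Fintype.card V - 1) + Fintype.card V * d) ≤
      (d : ℤ) ^ 2 - ((d % 2 : ℕ) : ℤ) + ((brC d pr ht).card : ℤ) ^ 2 -
        2 * (brC d pr ht).card + 2) :
    ∃ x al be, Shape d pr ht x al be := by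
  obtain ⟨g1, g2, g3⟩ := S.struct hG hn hb hd1 hd
  obtain ⟨x, hx, hx2, ho, hsum⟩ := S.special hG hn hb hd1 hd
  have h1 := S.mostar_ge hG
  have h2 := S.defi_ge hG hb
  have h3 := sum_mm d
  obtain ⟨k, l, h4, hk, hl⟩ := pos_bound d hd1 (brC d pr ht) brC_sub
  have h5 := off_split (d := d) (pr := pr) (ht := ht)
  have h6 := Finset.card_filter_add_card_filter_not (s := brC d pr ht) (fun i => 2 * i < d)
  set al := ((brC d pr ht).filter (fun i => 2 * i < d)).card with hal
  set be := ((brC d pr ht).filter (fun i => ¬ 2 * i < d)).card with hbe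
  have hmx := mm_pos hx
  rw [hsum] at h5
  have h8 := sq_nonneg ((al : ℤ) - be)
  have hkz : (0 : ℤ) ≤ k := by positivity
  have hlz : (0 : ℤ) ≤ l := by positivity
  have key : ((al : ℤ) - be) ^ 2 + 4 * k + 4 * l + 4 * (mm d x - 1) ≤ 2 := by linarith
  have hcl : ((al : ℤ) - be) ^ 2 ≤ 2 := by linarith
  have hk0 : k = 0 := by omega
  have hl0 : l = 0 := by omega
  have hm1 : mm d x = 1 := by omega
  have hx' := Finset.mem_Ico.1 hx
  refine ⟨x, al, be, g1, ?_, hx, hx2, ho, hk hk0, hl hl0, h6, ?_, ?_, ?_⟩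
  · unfold mm at hm1
    rcases min_cases (x : ℤ) ((d : ℤ) - x) with h | h <;> omega
  · have := (sq_le_two_elim hcl).1
    omega
  · have := (sq_le_two_elim hcl).2
    omega
  · have h9 : ((al : ℤ) + be) = (brC d pr ht).card := by omega
    rw [h9]
    linarith

lemma offc_reverse (hle : ∀ v, pr v ≤ d) {i : ℕ} (hi : i ≤ d) :
    offc (fun v => d - pr v) ht i = offc pr ht (d - i) := by
  unfold offc
  congr 1
  ext v
  have := hle v
  simp only [Finset.mem_filter, Finset.mem_univ, true_and]
  omega

lemma exists_shape (hG : G.IsTree) (hn : 2 ≤ Fintype.card V)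
    (S0 : Spine G d p pr ht)
    (hb0 : ∀ v, ht v ≤ pr v ∧ pr v + ht v ≤ d) (hd1 : 3 ≤ d)
    (hd : 2 * d + 1 = Fintype.card V + degreeTwoCount G) {r : ℕ}
    (hr : r + 1 + degreeTwoCount G = d)
    (hs : 2 * ((mostar G : ℤ) - Fintype.card V * (Fintype.card V - 1) + Fintype.card V * d) ≤
      (d : ℤ) ^ 2 - ((d % 2 : ℕ) : ℤ) + (r : ℤ) ^ 2 - 2 * r + 2) :
    ∃ p pr ht al be, Spine G d p pr ht ∧ (∀ v, ht v ≤ pr v ∧ pr v + ht v ≤ d) ∧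
      Shape d pr ht 1 al be ∧ al + be = r := by
  have hr0 : (brC d pr ht).card = r := by
    obtain ⟨g1, g2, g3⟩ := S0.struct hG hn hb0 (by omega) hd
    omega
  obtain ⟨x, al, be, H⟩ := S0.shape hG hn hb0 (by omega) hd (by rw [hr0]; exact hs)
  rcases H.xpos with h | h
  · subst h
    exact ⟨p, pr, ht, al, be, S0, hb0, H, by rw [H.sum, hr0]⟩
  · have S1 := S0.reverse
    have hb1 : ∀ v, ht v ≤ (fun v => d - pr v) v ∧ (fun v => d - pr v) v + ht v ≤ d := by
      intro v
      have := hb0 v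
      simp only
      omega
    have hr1 : (brC d (fun v => d - pr v) ht).card = r := by
      obtain ⟨g1, g2, g3⟩ := S1.struct hG hn hb1 (by omega) hd
      omega
    obtain ⟨y, al', be', H'⟩ := S1.shape hG hn hb1 (by omega) hd (by rw [hr1]; exact hs)
    have h2 : offc (fun v => d - pr v) ht 1 = 2 := by
      rw [offc_reverse S0.prle (by omega), ← h]
      exact H.x2
    have hy : y = 1 := by
      by_contra hy
      have := H'.oth 1 (Finset.mem_filter.2 ⟨Finset.mem_Ico.2 ⟨le_rfl, by omega⟩, by omega⟩)
        (fun h => hy h.symm)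
      omega
    subst hy
    exact ⟨_, _, ht, al', be', S1, hb1, H', by rw [H'.sum, hr1]⟩

lemma Spine.mostar_ge_left (S : Spine G d p pr ht) (hG : G.IsTree) (hd1 : 1 ≤ d) :
    (Fintype.card V : ℤ) * (Fintype.card V - 1) - Fintype.card V * d + 2 * defi d pr ht
      - (2 - ((d % 2 : ℕ) : ℤ)) * (Fintype.card V -
        2 * (Finset.univ.filter (fun v => 2 * pr v < d)).card)
      ≤ mostar G := by
  obtain ⟨c, hc⟩ : ∃ c, c = (d - 1) / 2 := ⟨_, rfl⟩
  have h1 := _root_.mostar_ge hG (p c)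
  have h2 : 2 * (distSum G (p c) : ℤ) = Fintype.card V * d - 2 * defi d pr ht +
      (2 - ((d % 2 : ℕ) : ℤ)) * (Fintype.card V -
        2 * (Finset.univ.filter (fun v => 2 * pr v < d)).card) := by
    rw [S.distSum_eq (by omega), defi, Finset.mul_sum, Finset.mul_sum, Finset.card_filter]
    have e1 : (Fintype.card V : ℤ) = ∑ v : V, (1 : ℤ) := by simp
    rw [e1]
    push_cast
    rw [Finset.mul_sum, ← Finset.sum_sub_distrib, Finset.mul_sum, Finset.sum_mul,
      ← Finset.sum_sub_distrib, ← Finset.sum_add_distrib]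
    apply Finset.sum_congr rfl
    intro v _
    have h1 := S.prle v
    unfold mm
    have hd2 : d % 2 = 0 ∨ d % 2 = 1 := by omega
    have hd3 : ((d : ℤ) % 2) = ((d % 2 : ℕ) : ℤ) := by omega
    rw [hd3]
    by_cases hh : 2 * pr v < d
    · rw [if_pos hh]
      rcases hd2 with h2 | h2 <;> rw [h2] <;>
      rcases abs_cases ((c : ℤ) - pr v) with h | h <;>
      rcases min_cases (pr v : ℤ) ((d : ℤ) - pr v) with h'' | h'' <;> omega
    · rw [if_neg hh]
      rcases hd2 with h2 | h2 <;> rw [h2] <;>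
      rcases abs_cases ((c : ℤ) - pr v) with h | h <;>
      rcases min_cases (pr v : ℤ) ((d : ℤ) - pr v) with h'' | h'' <;> omega
  linarith

lemma Spine.left_card (S : Spine G d p pr ht) (hG : G.IsTree) (hd1 : 3 ≤ d)
    (hb : ∀ v, ht v ≤ pr v ∧ pr v + ht v ≤ d) {al be : ℕ} (H : Shape d pr ht 1 al be) :
    (Finset.univ.filter (fun v => 2 * pr v < d)).card = (d + 1) / 2 + al + 1 := by
  have h1 := S.sum_path hG (fun v => if 2 * pr v < d then 1 else 0)
  have h2 := sum_off (V := V) hb (fun i => if 2 * i < d then 1 else 0)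
  have h3 : ∑ i ∈ Finset.range (d + 1), (if 2 * pr (p i) < d then (1 : ℤ) else 0) =
      ((d + 1) / 2 : ℕ) := by
    have : ∀ i ∈ Finset.range (d + 1), (if 2 * pr (p i) < d then (1 : ℤ) else 0) =
        if 2 * i < d then 1 else 0 := by
      intro i hi
      rw [(S.pr_p (i := i) (by simp at hi; omega)).1]
    rw [Finset.sum_congr rfl this, Finset.sum_boole]
    have h5 : (Finset.range (d + 1)).filter (fun i => 2 * i < d) = Finset.range ((d + 1) / 2) := by
      ext i
      simp only [Finset.mem_filter, Finset.mem_range]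
      omega
    rw [h5, Finset.card_range]
  have h1mem : 1 ∈ (brC d pr ht).filter (fun i => 2 * i < d) := by
    rw [Finset.mem_filter]
    refine ⟨Finset.mem_filter.2 ⟨H.xmem, ?_⟩, by omega⟩
    have := H.x2
    omega
  have h4 : ∑ i ∈ Finset.Ico 1 d, (offc pr ht i : ℤ) * (if 2 * i < d then 1 else 0) = al + 1 := by
    have e1 : ∑ i ∈ Finset.Ico 1 d, (offc pr ht i : ℤ) * (if 2 * i < d then 1 else 0) =
        ∑ i ∈ (brC d pr ht).filter (fun i => 2 * i < d), (offc pr ht i : ℤ) := by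
      symm
      rw [Finset.sum_filter]
      have e2 : ∑ i ∈ brC d pr ht, (if 2 * i < d then (offc pr ht i : ℤ) else 0) =
          ∑ i ∈ Finset.Ico 1 d, (if 2 * i < d then (offc pr ht i : ℤ) else 0) := by
        apply Finset.sum_subset brC_sub
        intro i hi hi2
        have : ¬ 1 ≤ offc pr ht i := fun h => hi2 (Finset.mem_filter.2 ⟨hi, h⟩)
        split_ifs <;> omega
      rw [e2]
      apply Finset.sum_congr rfl
      intro i _
      split_ifs <;> simp
    rw [e1, ← Finset.add_sum_erase _ _ h1mem, H.x2]
    have e3 : ∀ i ∈ ((brC d pr ht).filter (fun i => 2 * i < d)).erase 1,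
        (offc pr ht i : ℤ) = 1 := by
      intro i hi
      rw [Finset.mem_erase, Finset.mem_filter] at hi
      rw [H.oth i hi.2.1 hi.1]
      rfl
    rw [Finset.sum_congr rfl e3, Finset.sum_const, Finset.card_erase_of_mem h1mem]
    have h1mem' := h1mem
    rw [H.left] at h1mem' ⊢
    simp at h1mem' ⊢
    omega
  rw [h3] at h1
  rw [h4] at h2
  rw [Finset.sum_boole, Finset.filter_filter] at h1 h2
  have h6 : (Finset.univ.filter (fun v => 2 * pr v < d)) =
      (Finset.univ.filter (fun v => ht v = 0 ∧ 2 * pr v < d)) ∪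
      (Finset.univ.filter (fun v => ht v = 1 ∧ 2 * pr v < d)) := by
    ext v
    have := H.ht1 v
    simp only [Finset.mem_union, Finset.mem_filter, Finset.mem_univ, true_and]
    omega
  rw [h6, Finset.card_union_of_disjoint]
  · omega
  · rw [Finset.disjoint_left]
    intro v hv hv2
    have := (Finset.mem_filter.1 hv).2
    have := (Finset.mem_filter.1 hv2).2
    omega

lemma Spine.exclude (S : Spine G d p pr ht) (hG : G.IsTree) (hd1 : 3 ≤ d)
    (hb : ∀ v, ht v ≤ pr v ∧ pr v + ht v ≤ d) {al be : ℕ} (H : Shape d pr ht 1 al be)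
    (hd : 2 * d + 1 = Fintype.card V + degreeTwoCount G) {r : ℕ}
    (hr : r + 1 + degreeTwoCount G = d) (hal : al + be = r) (h : al = be + 1)
    (hs : 2 * ((mostar G : ℤ) - Fintype.card V * (Fintype.card V - 1) + Fintype.card V * d) ≤
      (d : ℤ) ^ 2 - ((d % 2 : ℕ) : ℤ) + (r : ℤ) ^ 2 - 2 * r + 1) : False := by
  have h1 := S.mostar_ge_left hG (by omega)
  rw [S.left_card hG hd1 hb H] at h1
  have h2 := H.hdefi
  have h3 : (2 - ((d % 2 : ℕ) : ℤ)) * (Fintype.card V - 2 * (((d + 1) / 2 + al + 1 : ℕ) : ℤ)) =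
      -2 := by
    have hd2 : d % 2 = 0 ∨ d % 2 = 1 := by omega
    rcases hd2 with h' | h' <;> rw [h'] <;> push_cast <;> omega
  rw [h3] at h1
  have h4 : ((al : ℤ) + be) = r := by omega
  have h5 : ((al : ℤ) - be) = 1 := by omega
  rw [h4, h5] at h2
  linarith

end ShapePart
section IsoPart

lemma iso_of_shape {n a b t d : ℕ} (hn : n = 2 * a + 2 * b + 5 + t) (hd : d = a + b + 2 + t)
    {G : SimpleGraph (Fin n)} (hG : G.IsTree) {p : ℕ → Fin n} {pr ht : Fin n → ℕ}
    (S : Spine G d p pr ht) (h1 : offc pr ht 1 = 2)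
    (hl : ∀ i, 1 ≤ i → i ≤ a + 1 → 1 ≤ offc pr ht i)
    (hr : ∀ i, d - b ≤ i → i < d → 1 ≤ offc pr ht i) : Nonempty (G ≃g catF n a b) := by
  have hw : ∀ i : ℕ, ∃ w : Fin n, 1 ≤ offc pr ht i → ht w = 1 ∧ pr w = i := by
    intro i
    by_cases h : 1 ≤ offc pr ht i
    · obtain ⟨w, hw⟩ := Finset.card_pos.1 (show 0 < offc pr ht i from h)
      exact ⟨w, fun _ => (Finset.mem_filter.1 hw).2⟩
    · exact ⟨p 0, fun h' => absurd h' h⟩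
  choose w hw using hw
  obtain ⟨u, hu, huw⟩ : ∃ u, u ∈ (Finset.univ.filter fun v => ht v = 1 ∧ pr v = 1) ∧ u ≠ w 1 := by
    apply Finset.exists_mem_ne
    show 1 < offc pr ht 1
    omega
  have hu := (Finset.mem_filter.1 hu).2
  have hc : ∀ v, d + 2 ≤ v → v < n → ht (w (cpar n a b v)) = 1 ∧
      pr (w (cpar n a b v)) = cpar n a b v := by
    intro v hv hvn
    apply hw
    by_cases hvb : v < n - b
    · apply hl
      · unfold cpar
        split_ifs <;> omega
      · unfold cpar
        split_ifs <;> omega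
    · apply hr
      · unfold cpar
        split_ifs <;> omega
      · unfold cpar
        split_ifs <;> omega
  have hc1 : cpar n a b (d + 1) = 1 := by
    unfold cpar
    split_ifs <;> omega
  have hc2 : cpar n a b (d + 2) = 1 := by
    unfold cpar
    split_ifs <;> omega
  set f : Fin n → Fin n := fun v => if v.val ≤ d then p v.val else
    if v.val = d + 1 then u else w (cpar n a b v.val) with hf
  have hpr : ∀ v, pr (f v) = prF n a b d v.val ∧ ht (f v) = if v.val ≤ d then 0 else 1 := by
    intro v
    simp only [hf]
    unfold prF
    by_cases hv : v.val ≤ d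
    · rw [if_pos hv, if_pos hv, if_pos hv]
      exact S.pr_p hv
    · rw [if_neg hv, if_neg hv, if_neg hv]
      by_cases hv1 : v.val = d + 1
      · rw [if_pos hv1, hv1, hc1]
        exact ⟨hu.2, hu.1⟩
      · rw [if_neg hv1]
        have := hc v.val (by omega) v.2
        exact ⟨this.2, this.1⟩
  have hinj : Function.Injective f := by
    intro x y hxy
    have hx := hpr x
    have hy := hpr y
    rw [hxy] at hx
    have e1 : prF n a b d x.val = prF n a b d y.val := by rw [← hx.1, hy.1]
    have e2 : (if x.val ≤ d then 0 else 1) = if y.val ≤ d then 0 else 1 := by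
      rw [← hx.2, hy.2]
    have hxn := x.2
    have hyn := y.2
    by_cases hxd : x.val ≤ d
    · have hyd : y.val ≤ d := by
        by_contra h
        rw [if_pos hxd, if_neg h] at e2
        omega
      unfold prF at e1
      rw [if_pos hxd, if_pos hyd] at e1
      exact Fin.ext e1
    · have hyd : ¬ y.val ≤ d := by
        intro h
        rw [if_neg hxd, if_pos h] at e2
        omega
      unfold prF at e1
      rw [if_neg hxd, if_neg hyd] at e1
      have e3 : x.val = y.val ∨ (x.val = d + 1 ∧ y.val = d + 2) ∨
          (x.val = d + 2 ∧ y.val = d + 1) := by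
        unfold cpar at e1
        split_ifs at e1 <;> omega
      simp only [hf] at hxy
      rw [if_neg hxd, if_neg hyd] at hxy
      rcases e3 with h | h | h
      · exact Fin.ext h
      · rw [if_pos h.1, if_neg (by omega), h.2, hc2] at hxy
        exact absurd hxy huw
      · rw [if_pos h.2, if_neg (by omega), h.1, hc2] at hxy
        exact absurd hxy.symm huw
  have hbij : Function.Bijective f := Finite.injective_iff_bijective.1 hinj
  set φ : Fin n ≃ Fin n := Equiv.ofBijective f hbij with hφ
  have hT' : (G.comap φ).IsTree := (Iso.comap φ G).isTree_iff.2 hG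
  have hpadj : ∀ x y : Fin n, x ≠ y → cpar n a b x.val = y.val → G.Adj (f x) (f y) := by
    intro x y hxy h
    have hxn := x.2
    have hyn := y.2
    have hyd : y.val ≤ d := by
      rw [← h]
      unfold cpar
      split_ifs <;> omega
    have hfy : f y = p y.val := by
      simp only [hf]
      rw [if_pos hyd]
    rw [hfy, S.adj_iff hyd, (hpr x).1, (hpr x).2]
    have hxy' : x.val ≠ y.val := fun h => hxy (Fin.ext h)
    by_cases hxd : x.val ≤ d
    · unfold prF
      rw [if_pos hxd, if_pos hxd]
      unfold cpar at h
      rw [if_pos (by omega)] at h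
      rw [abs_of_nonpos (by omega)]
      push_cast
      omega
    · unfold prF
      rw [if_neg hxd, if_neg hxd, h]
      simp
  have hle : catF n a b ≤ G.comap φ := by
    intro x y hxy
    rw [catF_eq, parent_adj] at hxy
    show G.Adj (f x) (f y)
    obtain ⟨hne, h | h⟩ := hxy
    · exact hpadj x y hne h
    · exact (hpadj y x hne.symm h).symm
  have heq : catF n a b = G.comap φ := by
    have hmin := isTree_iff_minimal_connected.1 hT'
    exact le_antisymm hle (hmin.2 (catF_isTree hn).1 hle)
  rw [heq]
  exact ⟨(Iso.comap φ G).symm⟩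

/-- combination of all the steps -/
lemma extremal_iso {n a b t d : ℕ} (hn : n = 2 * a + 2 * b + 5 + t) (hd : d = a + b + 2 + t)
    (hab : b = a + 1 ∨ b = a + 2) {T : SimpleGraph (Fin n)} (hT : T.IsTree)
    (h2 : degreeTwoCount T = t) (hmin : mostar T ≤ mostar (catF n a b)) :
    Nonempty (T ≃g catF n a b) := by
  have hF : 2 * ((mostar (catF n a b) : ℤ) - n * (n - 1) + n * d) ≤
      (d : ℤ) ^ 2 - ((d % 2 : ℕ) : ℤ) + ((a + b + 1 : ℕ) : ℤ) ^ 2 - 2 * ((a + b + 1 : ℕ) : ℤ) +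
        (if b = a + 1 then 2 * ((d % 2 : ℕ) : ℤ) else 1) := by
    rcases hab with h | h
    · subst h
      have := catF_mostar_one (n := n) (a := a) (t := t) (d := d) (by omega) (by omega)
      rw [if_pos rfl]
      push_cast at this ⊢
      linarith
    · subst h
      have := catF_mostar_two (n := n) (a := a) (t := t) (d := d) (by omega) (by omega)
      rw [if_neg (by omega)]
      push_cast at this ⊢
      linarith
  have hMF : (mostar T : ℤ) ≤ mostar (catF n a b) := by exact_mod_cast hmin
  have hcard : Fintype.card (Fin n) = n := Fintype.card_fin n
  have hn2 : 2 ≤ Fintype.card (Fin n) := by omega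
  obtain ⟨d', p, pr, ht, S, hb⟩ := exists_diam_spine hT
  have hd1 : 1 ≤ d' := by
    by_contra h
    have h0 : d' = 0 := by omega
    have key : ∀ v, v = p 0 := by
      intro v
      have h3 := hb v
      have h4 := S.eq_p hT (v := v) (by omega)
      rw [show pr v = 0 by omega] at h4
      exact h4
    have := (key ⟨0, by omega⟩).trans (key ⟨1, by omega⟩).symm
    have := congrArg Fin.val this
    simp at this
  have hdle := S.d_le hT hn2
  rw [hcard, h2] at hdle
  have hdd : d' ≤ d := by omega
  have hdd' : d' = d := by
    by_contra hne
    have h3 := S.short_bound hT hd1 hb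
    rw [hcard] at h3
    have h4 := S.brC_card_ge hT hd1
    rw [h2] at h4
    refine short_contra (n := n) (t := t) (d := d') (ds := d) (e := d - d')
      (r := (brC d' pr ht).card) (rs := a + b + 1) (by omega) (by omega) (by omega) (by omega)
      (by omega) (by omega) h3 (F := mostar (catF n a b)) ?_ hMF
    have h5 : ((d % 2 : ℕ) : ℤ) ≤ 1 := by omega
    have h6 : (if b = a + 1 then 2 * ((d % 2 : ℕ) : ℤ) else 1) ≤ ((d % 2 : ℕ) : ℤ) + 1 := by
      split_ifs <;> omega
    linarith
  subst hdd'
  have h6 : (if b = a + 1 then 2 * ((d' % 2 : ℕ) : ℤ) else 1) ≤ 2 := by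
    split_ifs <;> omega
  have hdn : 2 * d' + 1 = Fintype.card (Fin n) + degreeTwoCount T := by
    rw [hcard, h2]
    omega
  have hrt : (a + b + 1) + 1 + degreeTwoCount T = d' := by omega
  obtain ⟨p, pr, ht, al, be, S, hb, H, hsum⟩ := exists_shape hT hn2 S hb (by omega) hdn hrt (by
    rw [hcard]
    linarith)
  have hal : al = a + 1 ∧ be = b := by
    have c1 := H.close1
    have c2 := H.close2
    rcases hab with h | h
    · omega
    · by_cases hc : al = be + 1
      · exfalso
        refine S.exclude hT (by omega) hb H hdn hrt hsum hc ?_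
        rw [hcard]
        rw [if_neg (by omega)] at hF
        linarith
      · omega
  obtain ⟨rfl, rfl⟩ := hal
  refine iso_of_shape hn hd hT S H.x2 ?_ ?_
  · intro i hi1 hi2
    have : i ∈ (brC d' pr ht).filter (fun i => 2 * i < d') := by
      rw [H.left, Finset.mem_Icc]
      exact ⟨hi1, hi2⟩
    exact (Finset.mem_filter.1 (Finset.mem_filter.1 this).1).2
  · intro i hi1 hi2
    have : i ∈ (brC d' pr ht).filter (fun i => ¬ 2 * i < d') := by
      rw [H.right, Finset.mem_Icc]
      omega
    exact (Finset.mem_filter.1 (Finset.mem_filter.1 this).1).2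

end IsoPart
/-- if n - t is odd and n - t ≥ 7, the tree minimizing the Mostar index among
trees of order n with exactly t vertices of degree two (0 ≤ t ≤ n-4) is
F_{n,⌈(n-t-5)/4⌉-1,⌊(n-t-5)/4⌋+1}.  (In ℕ, ⌈m/4⌉ = (m+3)/4.) -/
theorem min_mostar_degree_two_odd (n t : ℕ) (ht : t ≤ n - 4) (hn : 4 ≤ n)
    (hodd : Odd (n - t)) (hnt : 7 ≤ n - t)
    (T : SimpleGraph (Fin n)) (hT : T.IsTree) (h2 : degreeTwoCount T = t)
    (hmin : ∀ T' : SimpleGraph (Fin n), T'.IsTree → degreeTwoCount T' = t →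
      mostar T ≤ mostar T') :
    Nonempty (T ≃g catF n ((n - t - 5 + 3) / 4 - 1) ((n - t - 5) / 4 + 1)) := by
  have hmin' := hmin (catF n ((n - t - 5 + 3) / 4 - 1) ((n - t - 5) / 4 + 1))
  obtain ⟨k, hk⟩ := hodd
  have hn' : n = 2 * ((n - t - 5 + 3) / 4 - 1) + 2 * ((n - t - 5) / 4 + 1) + 5 + t := by omega
  have hab : (n - t - 5) / 4 + 1 = ((n - t - 5 + 3) / 4 - 1) + 1 ∨
      (n - t - 5) / 4 + 1 = ((n - t - 5 + 3) / 4 - 1) + 2 := by omega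
  exact extremal_iso hn' rfl hab hT h2 (hmin' (catF_isTree hn') (catF_degreeTwo hn'))
end
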